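/- Let [C] ∈ 𝒱 be a nodal plane quartic over ℂ and L ⊂ ℙ² a line. Then: (i) if L ⊄ C is an inflection line of C with C ∩ L = {p,q} ⊂ C^{sm}, p ≠ q, and p the non-reduced point, then T_{[C]}𝒱_L ≅ H⁰(C, 𝒪_C(4)⊗𝒪_C(−2p)); (ii) if L ⊄ C, C ∩ L = {p,q} with p a node of C and q smooth, and ν: Cᵛ → C is the normalization at p with ν⁻¹(p) = {p₁,p₂} and L tangent to the branch corresponding to p₁, then T_{[C]}𝒱_L ≅ H⁰(Cᵛ, ν*𝒪_C(4)⊗𝒪_{Cᵛ}(−2p₁−p₂)); (iii) if L ⊂ C and p ∈ C^{sm} ∩ L, then [C] ∈ 𝒱_{L,p} and T_{[C]}𝒱_{L,p} ≅ H⁰(C, 𝒪_C(4)⊗𝒪_C(−3p)). -/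

import Mathlib

/-!
STATEMENT 17 (Pacini–Testa, Lemma `Tang`): let `[C] ∈ 𝒱` be a nodal plane quartic over
ℂ and `L ⊂ ℙ²` a line.  Then:
(i) if `L ⊄ C` is an inflection line of `C` with `C ∩ L = {p, q} ⊆ C^{sm}`, `p ≠ q`,
    `p` the non-reduced point, then `T_{[C]}𝒱_L ≃ H⁰(C, 𝒪_C(4) ⊗ 𝒪_C(−2p))`;
(ii) if `L ⊄ C`, `C ∩ L = {p, q}` with `p` a node of `C`, `q` smooth, and `L` tangent
    at `p` to the branch `p₁` of the normalization, then
    `T_{[C]}𝒱_L ≃ H⁰(Cᵛ, ν*𝒪_C(4) ⊗ 𝒪_{Cᵛ}(−2p₁ − p₂))`;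
(iii) if `L ⊆ C` and `p ∈ C^{sm} ∩ L`, then `[C] ∈ 𝒱_{L,p}` and
    `T_{[C]}𝒱_{L,p} ≃ H⁰(C, 𝒪_C(4) ⊗ 𝒪_C(−3p))`.

Formalization: `𝒱_L` (resp. `𝒱_{L,p}`) is the Zariski closure of the locus of
quartics in `𝒱` with `L ⊄ C` an inflection line (resp. with non-reduced intersection
point `p`), and the Zariski tangent space at `F` (of the affine cone, inside the
15-dimensional space of quartics) is the space of first-order deformations: those `G`
killed to first order by every polynomial in the coefficients vanishing on the locus.
The right-hand spaces are identified, via the restriction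
`H⁰(ℙ², 𝒪(4)) → H⁰(C, 𝒪_C(4))` (surjective with kernel `ℂ·F`), with the spaces of
quartics `G` whose restriction to `C` vanishes at `p` to order `≥ 2` along the branch
of `C` (resp. of the branch `p₁`, resp. to order `≥ 3` along the line `L ⊆ C`):
`G(p) = 0` and `∇G(p)·q = 0` (with `q` spanning `L` together with `p`), resp. the
first three coefficients of `G` restricted to a parametrization of `L` vanish.
-/
open MvPolynomial Polynomial Filter

noncomputable section

namespace Infl

variable {K : Type*} [Field K]

def dotv (w p : Fin 3 → K) : K := ∑ i, w i * p i

def lineRestrict (F : MvPolynomial (Fin 3) K) (a b : Fin 3 → K) : Polynomial K :=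
  MvPolynomial.aeval (fun i => Polynomial.C (a i) + Polynomial.C (b i) * Polynomial.X) F

def contactAt (F : MvPolynomial (Fin 3) K) (a b : Fin 3 → K) : ℕ :=
  (lineRestrict F a b).rootMultiplicity 0

def IsSmoothCurve (F : MvPolynomial (Fin 3) K) (d : ℕ) : Prop :=
  F.IsHomogeneous d ∧ F ≠ 0 ∧
    ∀ p : Fin 3 → K, p ≠ 0 → eval p F = 0 → ∃ i, eval p (pderiv i F) ≠ 0

/-- `n - 2`, the inflectionary weight of a point of contact order `n` on a plane quartic. -/
def padm (n : ℕ) : ℕ := n - 2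

/-- The multiplicity of the line through `a` and `b` in the configuration of the `24`
inflection lines (counted with multiplicity) of a smooth plane quartic `F`:
the sum, over the points of the line, of (contact order − 2). -/
def inflMultLine (F : MvPolynomial (Fin 3) ℂ) (a b : Fin 3 → ℂ) : ℕ :=
  ((lineRestrict F a b).roots.toFinset.sum fun t =>
    padm ((lineRestrict F a b).rootMultiplicity t)) + padm (contactAt F b a)

/-- The multiplicity of the line `{dotv w ⬝ = 0}` in the configuration of inflection
lines of the smooth plane quartic `F` (junk value at non-lines). -/
def inflMultDual (F : MvPolynomial (Fin 3) ℂ) (w : Fin 3 → ℂ) : ℕ :=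
  ⨆ a, ⨆ b, ⨆ _ : dotv w a = 0 ∧ dotv w b = 0 ∧ LinearIndependent ℂ ![a, b],
    inflMultLine F a b

/-- The projective plane dual: classes of nonzero vectors. -/
abbrev DualPlane := Projectivization ℂ (Fin 3 → ℂ)

/-- `w` and `w₀` are `ε`-close up to scaling. -/
def projNear (ε : ℝ) (w w₀ : Fin 3 → ℂ) : Prop := ∃ c : ℂ, ‖c • w - w₀‖ < ε

open Classical in
/-- Total multiplicity of the inflection lines of `F` that are `ε`-close to `w₀`. -/
def inflNear (F : MvPolynomial (Fin 3) ℂ) (w₀ : Fin 3 → ℂ) (ε : ℝ) : ℕ :=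
  ∑ᶠ l : DualPlane, if projNear ε l.rep w₀ then inflMultDual F l.rep else 0

/-- An algebraic family of plane quartics: a polynomial in `x₀,x₁,x₂` and the
parameter `t = X 3`; `fiberAt Q t` is the quartic at parameter value `t`. -/
def fiberAt (Q : MvPolynomial (Fin 4) ℂ) (t : ℂ) : MvPolynomial (Fin 3) ℂ :=
  MvPolynomial.aeval
    (fun i : Fin 4 => if h : (i : ℕ) < 3 then X ⟨i, h⟩ else MvPolynomial.C t) Q

/-- `Q` is a smoothing of the plane quartic `F₀` to (general) smooth plane quartics. -/
def IsQuarticSmoothing (Q : MvPolynomial (Fin 4) ℂ) (F₀ : MvPolynomial (Fin 3) ℂ) : Prop :=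
  fiberAt Q 0 = F₀ ∧ (∀ t, (fiberAt Q t).IsHomogeneous 4) ∧
    ∀ᶠ t in nhdsWithin (0 : ℂ) {0}ᶜ, IsSmoothCurve (fiberAt Q t) 4

/-- `μ` is the limit, as `t → 0`, of the configurations of the `24` inflection lines of
the fibers of the family `Q`. -/
def IsLimitConfigAlong (Q : MvPolynomial (Fin 4) ℂ) (μ : (Fin 3 → ℂ) → ℕ) : Prop :=
  ∀ w₀ : Fin 3 → ℂ, w₀ ≠ 0 →
    ∀ᶠ ε in nhdsWithin (0 : ℝ) (Set.Ioi 0),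
      ∀ᶠ t in nhdsWithin (0 : ℂ) {0}ᶜ, inflNear (fiberAt Q t) w₀ ε = μ w₀

/-- `μ` is *the* configuration of limit inflection lines of the quartic `F₀`: it is
scale invariant and is the limit of the configurations of inflection lines along every
smoothing of `F₀` to plane quartics. -/
def IsLimitConfig (F₀ : MvPolynomial (Fin 3) ℂ) (μ : (Fin 3 → ℂ) → ℕ) : Prop :=
  (∀ c : ℂ, c ≠ 0 → ∀ w, μ (c • w) = μ w) ∧
    ∀ Q, IsQuarticSmoothing Q F₀ → IsLimitConfigAlong Q μ

def transformPoly (g : Matrix (Fin 3) (Fin 3) ℂ) (F : MvPolynomial (Fin 3) ℂ) :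
    MvPolynomial (Fin 3) ℂ :=
  MvPolynomial.aeval (fun i => ∑ j, MvPolynomial.C (g i j) * X j) F

/-- GIT-semistability for plane quartics (Hilbert–Mumford criterion). -/
def GITSemistable (F : MvPolynomial (Fin 3) ℂ) : Prop :=
  ∀ g : GL (Fin 3) ℂ, ∀ a : Fin 3 → ℤ, (∑ i, a i) = 0 →
    ∃ m ∈ (transformPoly (g : Matrix (Fin 3) (Fin 3) ℂ) F).support,
      (∑ i, (m i : ℤ) * a i) ≤ 0

/-- The stabilizer of `F` in `PGL₃` is finite. -/
def ProjStabFinite (F : MvPolynomial (Fin 3) ℂ) : Prop :=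
  ∃ S : Set (Matrix (Fin 3) (Fin 3) ℂ), S.Finite ∧
    ∀ g : GL (Fin 3) ℂ, (∃ c : ℂ, c ≠ 0 ∧ transformPoly (g : Matrix (Fin 3) (Fin 3) ℂ) F = c • F) →
      ∃ h ∈ S, ∃ c : ℂ, c ≠ 0 ∧ (g : Matrix (Fin 3) (Fin 3) ℂ) = c • h

/-- `[F] ∈ 𝒱`: `F` is a reduced plane quartic, GIT-semistable with finite stabilizer. -/
def memV (F : MvPolynomial (Fin 3) ℂ) : Prop :=
  F.IsHomogeneous 4 ∧ Squarefree F ∧ GITSemistable F ∧ ProjStabFinite F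

/-- Evaluation of a polynomial `Φ` in the coefficients of plane quartics at `F`. -/
def coeffEval (Φ : MvPolynomial (Fin 3 →₀ ℕ) ℂ) (F : MvPolynomial (Fin 3) ℂ) : ℂ :=
  MvPolynomial.eval (fun d => F.coeff d) Φ

/-- The Zariski closure, in the space of ternary quartics, of a set of quartics. -/
def ZarClosure (S : Set (MvPolynomial (Fin 3) ℂ)) : Set (MvPolynomial (Fin 3) ℂ) :=
  {F | ∀ Φ : MvPolynomial (Fin 3 →₀ ℕ) ℂ, (∀ G ∈ S, coeffEval Φ G = 0) → coeffEval Φ F = 0}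


def SmoothAt (F : MvPolynomial (Fin 3) ℂ) (p : Fin 3 → ℂ) : Prop :=
  eval p F = 0 ∧ ∃ i, eval p (pderiv i F) ≠ 0

def SingAt (F : MvPolynomial (Fin 3) ℂ) (p : Fin 3 → ℂ) : Prop :=
  eval p F = 0 ∧ ∀ i, eval p (pderiv i F) = 0

def hessMat (F : MvPolynomial (Fin 3) ℂ) (p : Fin 3 → ℂ) : Matrix (Fin 3) (Fin 3) ℂ :=
  Matrix.of fun i j => eval p (pderiv i (pderiv j F))

def IsNodeAt (F : MvPolynomial (Fin 3) ℂ) (p : Fin 3 → ℂ) : Prop :=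
  SingAt F p ∧ (hessMat F p).rank = 2

def gradVec (F : MvPolynomial (Fin 3) ℂ) (p : Fin 3 → ℂ) : Fin 3 → ℂ :=
  fun i => eval p (pderiv i F)

def linForm (w : Fin 3 → ℂ) : MvPolynomial (Fin 3) ℂ := ∑ i, MvPolynomial.C (w i) * X i

def propor (p q : Fin 3 → ℂ) : Prop := ∃ c : ℂ, c ≠ 0 ∧ p = c • q

/-- First-order variation: `(d/dε) Φ(F + ε G) |_{ε = 0}`, for a polynomial `Φ` in the
coefficients of plane quartics. -/
def derivEval (Φ : MvPolynomial (Fin 3 →₀ ℕ) ℂ) (F G : MvPolynomial (Fin 3) ℂ) : ℂ :=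
  Polynomial.eval 0 (Polynomial.derivative
    (MvPolynomial.aeval
      (fun d => Polynomial.C (F.coeff d) + Polynomial.C (G.coeff d) * Polynomial.X) Φ))

/-- The Zariski tangent space at `F` of (the affine cone over) a locus `S` of plane
quartics: the set of first-order deformations `F + ε G` annihilated by every
polynomial in the coefficients vanishing on `S`. -/
def TangentAt (S : Set (MvPolynomial (Fin 3) ℂ)) (F : MvPolynomial (Fin 3) ℂ) :
    Set (MvPolynomial (Fin 3) ℂ) :=
  {G | ∀ Φ : MvPolynomial (Fin 3 →₀ ℕ) ℂ,
    (∀ H ∈ S, coeffEval Φ H = 0) → derivEval Φ F G = 0}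

/-- `𝒱⁰_L`: quartics of `𝒱` not containing the line dual to `w` and having it as an
inflection line. -/
def memV0L (w : Fin 3 → ℂ) (F : MvPolynomial (Fin 3) ℂ) : Prop :=
  memV F ∧ ¬ linForm w ∣ F ∧ ∃ a b : Fin 3 → ℂ, dotv w a = 0 ∧ dotv w b = 0 ∧
    LinearIndependent ℂ ![a, b] ∧ 3 ≤ contactAt F a b

/-- `𝒱⁰_{L,p}`: as above, with `p` the non-reduced point of `C ∩ L`. -/
def memV0Lp (w p : Fin 3 → ℂ) (F : MvPolynomial (Fin 3) ℂ) : Prop :=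
  memV F ∧ ¬ linForm w ∣ F ∧ ∃ b : Fin 3 → ℂ, dotv w b = 0 ∧
    LinearIndependent ℂ ![p, b] ∧ 3 ≤ contactAt F p b

/-- (The affine cone over) `𝒱_L`, the closure of `𝒱⁰_L`. -/
def VL (w : Fin 3 → ℂ) : Set (MvPolynomial (Fin 3) ℂ) :=
  ZarClosure {F | memV0L w F}

/-- (The affine cone over) `𝒱_{L,p}`, the closure of `𝒱⁰_{L,p}`. -/
def VLp (w p : Fin 3 → ℂ) : Set (MvPolynomial (Fin 3) ℂ) :=
  ZarClosure {F | memV0Lp w p F}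

/-! ### Linear changes of coordinates and nodes -/

lemma eval_transformPoly (g : Matrix (Fin 3) (Fin 3) ℂ) (F : MvPolynomial (Fin 3) ℂ)
    (x : Fin 3 → ℂ) : eval x (transformPoly g F) = eval (g.mulVec x) F := by
  unfold transformPoly
  induction F using MvPolynomial.induction_on with
  | C a => simp
  | add p q hp hq => simp only [map_add, hp, hq]
  | mul_X p i hp =>
    simp only [map_mul, hp, MvPolynomial.aeval_X, MvPolynomial.eval_X]
    congr 1
    simp [Matrix.mulVec, dotProduct]

lemma transformPoly_mul (g h : Matrix (Fin 3) (Fin 3) ℂ) (F : MvPolynomial (Fin 3) ℂ) :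
    transformPoly (g * h) F = transformPoly h (transformPoly g F) := by
  apply MvPolynomial.funext
  intro x
  simp [eval_transformPoly, Matrix.mulVec_mulVec]

lemma transformPoly_homog (g : Matrix (Fin 3) (Fin 3) ℂ) {F : MvPolynomial (Fin 3) ℂ} {n : ℕ}
    (hF : F.IsHomogeneous n) : (transformPoly g F).IsHomogeneous n := by
  have := hF.aeval (fun i => ∑ j, MvPolynomial.C (g i j) * X j) (n := 1) (fun i => by
    apply MvPolynomial.IsHomogeneous.sum
    intro j _
    simpa using (isHomogeneous_C (Fin 3) (g i j)).mul (isHomogeneous_X ℂ j))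
  simpa [transformPoly] using this

lemma pderiv_transformPoly (g : Matrix (Fin 3) (Fin 3) ℂ) (F : MvPolynomial (Fin 3) ℂ)
    (i : Fin 3) : pderiv i (transformPoly g F) =
      ∑ j, MvPolynomial.C (g j i) * transformPoly g (pderiv j F) := by
  unfold transformPoly
  induction F using MvPolynomial.induction_on with
  | C a => simp
  | add p q hp hq => simp only [map_add, hp, hq, mul_add, Finset.sum_add_distrib]
  | mul_X p k hp =>
    have h1 : pderiv i (∑ j, MvPolynomial.C (g k j) * X j : MvPolynomial (Fin 3) ℂ)
        = MvPolynomial.C (g k i) := by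
      simp [pderiv_C_mul, pderiv_X, Pi.single_apply]
    rw [map_mul, MvPolynomial.aeval_X, Derivation.leibniz, h1, hp]
    have h2 : ∀ j, MvPolynomial.C (g j i) *
        (MvPolynomial.aeval fun i => ∑ j, MvPolynomial.C (g i j) * MvPolynomial.X j)
          (pderiv j (p * MvPolynomial.X k)) =
        (if j = k then MvPolynomial.C (g k i) * (MvPolynomial.aeval
          fun i => ∑ j, MvPolynomial.C (g i j) * MvPolynomial.X j) p else 0)
        + (∑ j, MvPolynomial.C (g k j) * MvPolynomial.X j) * (MvPolynomial.C (g j i) *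
        (MvPolynomial.aeval fun i => ∑ j, MvPolynomial.C (g i j) * MvPolynomial.X j)
          (pderiv j p)) := by
      intro j
      rw [Derivation.leibniz, map_add, smul_eq_mul, smul_eq_mul, map_mul, map_mul,
        MvPolynomial.aeval_X, pderiv_X]
      by_cases hjk : j = k
      · subst hjk
        simp only [Pi.single_eq_same, map_one, if_true]
        ring
      · simp only [Pi.single_eq_of_ne (Ne.symm hjk), map_zero, if_neg hjk]
        ring
    rw [Finset.sum_congr rfl (fun j _ => h2 j), Finset.sum_add_distrib, ← Finset.mul_sum,
      Finset.sum_ite_eq' Finset.univ k]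
    simp only [smul_eq_mul, Finset.mem_univ, if_true]
    ring

/-- All singular points are nodes. -/
def Nodal (F : MvPolynomial (Fin 3) ℂ) : Prop :=
  ∀ x : Fin 3 → ℂ, x ≠ 0 → SingAt F x → IsNodeAt F x

lemma gradVec_transform (g : Matrix (Fin 3) (Fin 3) ℂ) (F : MvPolynomial (Fin 3) ℂ)
    (x : Fin 3 → ℂ) : gradVec (transformPoly g F) x = g.transpose.mulVec (gradVec F (g.mulVec x)) := by
  funext i
  simp [gradVec, pderiv_transformPoly, eval_transformPoly, Matrix.mulVec, dotProduct]

lemma hessMat_transform (g : Matrix (Fin 3) (Fin 3) ℂ) (F : MvPolynomial (Fin 3) ℂ)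
    (x : Fin 3 → ℂ) : hessMat (transformPoly g F) x = g.transpose * hessMat F (g.mulVec x) * g := by
  ext i j
  simp only [hessMat, Matrix.of_apply, pderiv_transformPoly, map_sum, pderiv_C_mul, map_mul,
    MvPolynomial.eval_C, eval_transformPoly, Matrix.mul_apply, Matrix.transpose_apply, Finset.sum_mul,
    Finset.mul_sum]
  refine Finset.sum_congr rfl fun a _ => Finset.sum_congr rfl fun b _ => ?_
  ring

lemma Nodal.transform {F : MvPolynomial (Fin 3) ℂ} (hF : Nodal F)
    {g : Matrix (Fin 3) (Fin 3) ℂ} (hg : IsUnit g.det) : Nodal (transformPoly g F) := by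
  intro x hx hs
  have hgt : IsUnit g.transpose.det := by rwa [Matrix.det_transpose]
  have hinj : Function.Injective g.mulVec := by
    rw [Matrix.mulVec_injective_iff_isUnit]; exact (Matrix.isUnit_iff_isUnit_det g).2 hg
  have hinjt : Function.Injective g.transpose.mulVec := by
    rw [Matrix.mulVec_injective_iff_isUnit]; exact (Matrix.isUnit_iff_isUnit_det _).2 hgt
  have h0 : g.mulVec x ≠ 0 := by
    intro h; exact hx (hinj (by simpa using h))
  have hs' : SingAt F (g.mulVec x) := by
    refine ⟨by simpa [eval_transformPoly] using hs.1, ?_⟩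
    have : gradVec (transformPoly g F) x = 0 := funext hs.2
    rw [gradVec_transform] at this
    have h2 : gradVec F (g.mulVec x) = 0 := hinjt (by simpa using this)
    exact fun i => congrFun h2 i
  refine ⟨hs, ?_⟩
  rw [hessMat_transform, Matrix.rank_mul_eq_left_of_isUnit_det _ _ hg,
    Matrix.rank_mul_eq_right_of_isUnit_det _ _ hgt]
  exact (hF _ h0 hs').2

lemma rank_le_one_of_minors (H : Matrix (Fin 3) (Fin 3) ℂ)
    (h : ∀ i j k l, H i k * H j l = H i l * H j k) : H.rank ≤ 1 := by
  by_cases h0 : H = 0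
  · simp [h0]
  · obtain ⟨a, b, hab⟩ : ∃ a b, H a b ≠ 0 := by
      by_contra hc
      push Not at hc
      exact h0 (Matrix.ext hc)
    have : H = Matrix.vecMulVec (fun i => H i b / H a b) (fun j => H a j) := by
      ext i j
      simp only [Matrix.vecMulVec_apply]
      field_simp
      linear_combination h i a j b
    rw [this]
    exact Matrix.rank_vecMulVec_le _ _

lemma two_le_rank_of_minor (H : Matrix (Fin 3) (Fin 3) ℂ) (i j k l : Fin 3)
    (h : H i k * H j l - H i l * H j k ≠ 0) : 2 ≤ H.rank := by
  have h1 := Matrix.rank_submatrix_le H ![i, j] ![k, l]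
  have h2 : (H.submatrix ![i, j] ![k, l]).rank = 2 := by
    have : IsUnit (H.submatrix ![i, j] ![k, l]) := by
      rw [Matrix.isUnit_iff_isUnit_det, isUnit_iff_ne_zero, Matrix.det_fin_two]
      simpa using h
    simpa using Matrix.rank_of_isUnit _ this
  omega

lemma euler_eval {F : MvPolynomial (Fin 3) ℂ} {n : ℕ} (hF : F.IsHomogeneous n)
    (x : Fin 3 → ℂ) : ∑ i, x i * eval x (pderiv i F) = n * eval x F := by
  have := congrArg (MvPolynomial.eval x) hF.sum_X_mul_pderiv
  simpa using this

lemma rank_le_two_of_sing {F : MvPolynomial (Fin 3) ℂ} {n : ℕ} (hF : F.IsHomogeneous n)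
    {x : Fin 3 → ℂ} (hx : x ≠ 0) (hs : SingAt F x) : (hessMat F x).rank ≤ 2 := by
  by_contra hc
  have h3 : (hessMat F x).rank = 3 := by
    have := Matrix.rank_le_card_width (hessMat F x)
    simp at this
    omega
  have hu : IsUnit (hessMat F x) := by
    rw [← Matrix.mulVec_injective_iff_isUnit]
    have hr : Module.finrank ℂ (LinearMap.range (hessMat F x).mulVecLin) = 3 := h3
    have hsurj : LinearMap.range (hessMat F x).mulVecLin = ⊤ :=
      Submodule.eq_top_of_finrank_eq (by rw [hr]; simp)
    have := LinearMap.injective_iff_surjective.2 (LinearMap.range_eq_top.1 hsurj)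
    exact this
  have hsymm : ∀ i, (hessMat F x).vecMul x i = 0 := by
    intro i
    have := euler_eval (hF.pderiv (i := i)) x
    rw [hs.2 i, mul_zero] at this
    simpa [Matrix.vecMul, dotProduct, hessMat] using this
  have hinj := Matrix.vecMul_injective_iff_isUnit.2 hu
  exact hx (hinj (by change Matrix.vecMul _ _ = Matrix.vecMul _ _; rw [Matrix.zero_vecMul]; exact _root_.funext hsymm))

lemma nodal_iff {F : MvPolynomial (Fin 3) ℂ} {n : ℕ} (hF : F.IsHomogeneous n) :
    Nodal F ↔ ∀ x : Fin 3 → ℂ, x ≠ 0 → SingAt F x →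
      ∃ i j k l, hessMat F x i k * hessMat F x j l - hessMat F x i l * hessMat F x j k ≠ 0 := by
  constructor
  · intro h x hx hs
    by_contra hc
    push Not at hc
    have := rank_le_one_of_minors (hessMat F x) (fun i j k l => sub_eq_zero.1 (hc i j k l))
    have := (h x hx hs).2
    omega
  · intro h x hx hs
    obtain ⟨i, j, k, l, hm⟩ := h x hx hs
    exact ⟨hs, le_antisymm (rank_le_two_of_sing hF hx hs) (two_le_rank_of_minor _ i j k l hm)⟩

lemma eval_single_homog {T : MvPolynomial (Fin 3) ℂ} {n : ℕ} (hT : T.IsHomogeneous n)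
    (k : Fin 3) : eval (Pi.single k (1 : ℂ)) T = coeff (Finsupp.single k n) T := by
  classical
  rw [MvPolynomial.eval_eq]
  have key : ∀ d ∈ T.support, d ≠ Finsupp.single k n →
      coeff d T * ∏ i ∈ d.support, (Pi.single k (1 : ℂ) : Fin 3 → ℂ) i ^ d i = 0 := by
    intro d hd hne
    have hdeg : d.degree = n := by
      rw [Finsupp.degree_eq_weight_one]
      exact hT (MvPolynomial.mem_support_iff.1 hd)
    have : ∃ i, i ≠ k ∧ d i ≠ 0 := by
      by_contra hc
      push Not at hc
      have h1 : d = Finsupp.single k (d k) := by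
        ext i
        by_cases hi : i = k
        · subst hi; simp
        · simp [Finsupp.single_apply, Ne.symm hi, hc i hi]
      rw [h1] at hdeg
      rw [Finsupp.degree_single] at hdeg
      rw [hdeg] at h1
      exact hne h1
    obtain ⟨i, hik, hi⟩ := this
    rw [Finset.prod_eq_zero (Finsupp.mem_support_iff.2 hi)]
    · simp
    · simp [Pi.single_apply, hik, hi]
  by_cases hmem : Finsupp.single k n ∈ T.support
  · rw [Finset.sum_eq_single_of_mem _ hmem key]
    rw [Finset.prod_eq_one]
    · simp
    · intro i hi
      by_cases hik : i = k
      · subst hik; simp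
      · simp [Ne.symm hik] at hi
  · rw [MvPolynomial.notMem_support_iff.1 hmem]
    apply Finset.sum_eq_zero
    intro d hd
    exact key d hd (fun h => hmem (h ▸ hd))

/-- Key local fact: at a coordinate vertex a nodal quartic has a nonzero coefficient among five. -/
lemma Nodal.vertex {T : MvPolynomial (Fin 3) ℂ} (hT : T.IsHomogeneous 4) (hN : Nodal T)
    (k i j : Fin 3) (hki : k ≠ i) (hkj : k ≠ j) (hij : i ≠ j)
    (h4 : coeff (Finsupp.single k 4) T = 0)
    (h3i : coeff (Finsupp.single k 3 + Finsupp.single i 1) T = 0)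
    (h3j : coeff (Finsupp.single k 3 + Finsupp.single j 1) T = 0)
    (h2ij : coeff (Finsupp.single k 2 + Finsupp.single i 1 + Finsupp.single j 1) T = 0)
    (h2ii : coeff (Finsupp.single k 2 + Finsupp.single i 1 + Finsupp.single i 1) T = 0) :
    False := by
  classical
  have hall : ∀ a : Fin 3, a = k ∨ a = i ∨ a = j := by
    clear h4 h3i h3j h2ij h2ii
    revert k i j; decide
  have hk4 : Finsupp.single k 3 + Finsupp.single k 1 = (Finsupp.single k 4 : Fin 3 →₀ ℕ) := by
    rw [← Finsupp.single_add]
  have hk3 : Finsupp.single k 2 + Finsupp.single k 1 = (Finsupp.single k 3 : Fin 3 →₀ ℕ) := by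
    rw [← Finsupp.single_add]
  have hx : (Pi.single k (1 : ℂ) : Fin 3 → ℂ) ≠ 0 := by
    intro h; simpa using congrFun h k
  have hg : ∀ a, coeff (Finsupp.single k 3 + Finsupp.single a 1) T = 0 := by
    intro a
    rcases hall a with rfl | rfl | rfl
    · rw [hk4]; exact h4
    · exact h3i
    · exact h3j
  have hs : SingAt T (Pi.single k 1) := by
    refine ⟨by rw [eval_single_homog hT, h4], fun a => ?_⟩
    rw [eval_single_homog (hT.pderiv (i := a)), coeff_pderiv, hg a, zero_mul]
  have hH : ∀ a b, hessMat T (Pi.single k 1) a b ≠ 0 → a = j ∧ b = j := by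
    intro a b hab
    have e : hessMat T (Pi.single k 1) a b = coeff (Finsupp.single k 2 + Finsupp.single a 1
        + Finsupp.single b 1) T * (((Finsupp.single k 2 + Finsupp.single a 1 : Fin 3 →₀ ℕ) b : ℂ) + 1)
        * (((Finsupp.single k 2 : Fin 3 →₀ ℕ) a : ℂ) + 1) := by
      simp only [hessMat, Matrix.of_apply]
      rw [eval_single_homog ((hT.pderiv (i := b)).pderiv (i := a)), coeff_pderiv, coeff_pderiv]
    have hc : coeff (Finsupp.single k 2 + Finsupp.single a 1 + Finsupp.single b 1) T ≠ 0 := by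
      intro h
      rw [e, h] at hab
      simp at hab
    rcases hall a with rfl | rfl | rfl
    · rw [hk3] at hc; exact absurd (hg b) hc
    · rcases hall b with rfl | rfl | rfl
      · rw [add_right_comm, hk3] at hc; exact absurd (hg a) hc
      · exact absurd h2ii hc
      · exact absurd h2ij hc
    · rcases hall b with rfl | rfl | rfl
      · rw [add_right_comm, hk3] at hc; exact absurd (hg a) hc
      · rw [add_right_comm] at hc; exact absurd h2ij hc
      · exact ⟨rfl, rfl⟩
  obtain ⟨a, b, c, d, hm⟩ := (nodal_iff hT).1 hN _ hx hs
  by_cases h1 : hessMat T (Pi.single k 1) a c * hessMat T (Pi.single k 1) b d = 0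
  · have h2 : hessMat T (Pi.single k 1) a d * hessMat T (Pi.single k 1) b c ≠ 0 := by
      intro h; rw [h1, h] at hm; simp at hm
    obtain ⟨rfl, rfl⟩ := hH _ _ (left_ne_zero_of_mul h2)
    obtain ⟨rfl, rfl⟩ := hH _ _ (right_ne_zero_of_mul h2)
    simp at hm
  · obtain ⟨rfl, rfl⟩ := hH _ _ (left_ne_zero_of_mul h1)
    obtain ⟨rfl, rfl⟩ := hH _ _ (right_ne_zero_of_mul h1)
    simp at hm

lemma Nodal.semistable {F : MvPolynomial (Fin 3) ℂ} (hF : F.IsHomogeneous 4) (hN : Nodal F) :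
    GITSemistable F := by
  intro g a ha
  by_contra hc
  push Not at hc
  set T := transformPoly (g : Matrix (Fin 3) (Fin 3) ℂ) F with hTdef
  have hT : T.IsHomogeneous 4 := transformPoly_homog _ hF
  have hTN : Nodal T := hN.transform ((Matrix.isUnit_iff_isUnit_det _).1 g.isUnit)
  have hz : ∀ m : Fin 3 →₀ ℕ, (∑ i, (m i : ℤ) * a i) ≤ 0 → coeff m T = 0 := by
    intro m hm
    by_contra hne
    exact absurd (hc m (MvPolynomial.mem_support_iff.2 hne)) (not_lt.2 hm)
  have main : ∀ k i j : Fin 3, k ≠ i → k ≠ j → i ≠ j → a k + a i + a j = 0 →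
      ¬ (a k ≤ a i ∧ a k ≤ a j ∧ 0 ≤ a j) := by
    intro k i j hki hkj hij hsum ⟨h1, h2, h3⟩
    have hsums : ∀ f : Fin 3 → ℤ, ∑ x, f x = f k + f i + f j := by
      intro f
      rw [Fin.sum_univ_three]
      revert k i j
      intro k i j
      fin_cases k <;> fin_cases i <;> fin_cases j <;> simp <;> intros <;> ring
    refine hTN.vertex hT k i j hki hkj hij ?_ ?_ ?_ ?_ ?_ <;> apply hz <;> rw [hsums] <;>
      simp [Finsupp.single_apply, hki, hkj, hij, hki.symm, hkj.symm, hij.symm] <;> linarith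
  rw [Fin.sum_univ_three] at ha
  have := main 0 1 2 (by decide) (by decide) (by decide) (by linarith)
  have := main 0 2 1 (by decide) (by decide) (by decide) (by linarith)
  have := main 1 0 2 (by decide) (by decide) (by decide) (by linarith)
  have := main 1 2 0 (by decide) (by decide) (by decide) (by linarith)
  have := main 2 0 1 (by decide) (by decide) (by decide) (by linarith)
  have := main 2 1 0 (by decide) (by decide) (by decide) (by linarith)
  omega

/-! ### Nodal quartics are reduced -/

lemma exists_zero_of_not_isUnit {A : MvPolynomial (Fin 3) ℂ} (hA : ¬ IsUnit A) :
    ∃ x : Fin 3 → ℂ, x ≠ 0 ∧ MvPolynomial.eval x A = 0 := by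
  by_contra hc
  push Not at hc
  have key : ∀ i : Fin 3, ∃ n : ℕ, A ∣ (MvPolynomial.X i) ^ n := by
    intro i
    have h1 : (MvPolynomial.X i : MvPolynomial (Fin 3) ℂ) ∈
        (Ideal.span {A}).radical := by
      rw [← MvPolynomial.vanishingIdeal_zeroLocus_eq_radical (K := ℂ),
        MvPolynomial.mem_vanishingIdeal_iff]
      intro x hx
      rw [MvPolynomial.mem_zeroLocus_iff] at hx
      have h2 := hx A (Ideal.mem_span_singleton_self A)
      by_cases hx0 : x = 0
      · simp [hx0]
      · exact absurd (by simpa [MvPolynomial.aeval_eq_eval] using h2) (hc x hx0)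
    obtain ⟨n, hn⟩ := h1
    exact ⟨n, Ideal.mem_span_singleton.1 hn⟩
  obtain ⟨n, hn⟩ := key 0
  obtain ⟨m, hm⟩ := key 1
  obtain ⟨i, _, hi⟩ := (dvd_prime_pow (MvPolynomial.X_prime (R := ℂ) (i := (0 : Fin 3))) n).1 hn
  rcases Nat.eq_zero_or_pos i with rfl | hpos
  · exact hA (by simpa using hi.isUnit_iff.2 (by simp))
  · have h3 : (MvPolynomial.X 0 : MvPolynomial (Fin 3) ℂ) ∣ MvPolynomial.X 1 ^ m :=
      (dvd_pow_self _ hpos.ne').trans (hi.symm.dvd.trans hm)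
    have h4 := (MvPolynomial.X_prime (R := ℂ) (i := (0 : Fin 3))).dvd_of_dvd_pow h3
    rw [MvPolynomial.X_dvd_X] at h4
    simp at h4

lemma Nodal.squarefree {F : MvPolynomial (Fin 3) ℂ} (hF : F.IsHomogeneous 4) (hN : Nodal F) :
    Squarefree F := by
  intro A hA
  by_contra hu
  obtain ⟨B, rfl⟩ := hA
  obtain ⟨x, hx, hx0⟩ := exists_zero_of_not_isUnit hu
  have hs : SingAt (A * A * B) x := by
    refine ⟨by simp [hx0], fun i => by simp [Derivation.leibniz, hx0]⟩
  obtain ⟨i, j, k, l, hm⟩ := (nodal_iff hF).1 hN x hx hs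
  apply hm
  simp [hessMat, Derivation.leibniz, hx0]
  ring

/-! ### Bounded algebraic sets are finite -/

lemma finite_of_bounded {σ : Type} [Finite σ] (I : Ideal (MvPolynomial σ ℂ)) (M : ℝ)
    (hM : ∀ z : σ → ℂ, (∀ P ∈ I, MvPolynomial.eval z P = 0) → ∀ i, ‖z i‖ ≤ M) :
    {z : σ → ℂ | ∀ P ∈ I, MvPolynomial.eval z P = 0}.Finite := by
  classical
  have := Fintype.ofFinite σ
  by_cases hI : I = ⊤
  · have : {z : σ → ℂ | ∀ P ∈ I, MvPolynomial.eval z P = 0} = ∅ := by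
      ext z
      simp only [Set.mem_ofPred_eq, Set.mem_empty_iff_false, iff_false]
      intro h
      have := h 1 (by rw [hI]; trivial)
      simp at this
    rw [this]; exact Set.finite_empty
  have hnt : Nontrivial (MvPolynomial σ ℂ ⧸ I) := Ideal.Quotient.nontrivial_iff.2 hI
  obtain ⟨s, φ, hinj, hintg⟩ := exists_integral_inj_algHom_of_fg ℂ (MvPolynomial σ ℂ ⧸ I)
  rcases Nat.eq_zero_or_pos s with rfl | hs
  · -- each coordinate is integral over `ℂ`
    have hfin : ∀ i : σ, ∃ p : Polynomial ℂ, p ≠ 0 ∧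
        ∀ z : σ → ℂ, (∀ P ∈ I, MvPolynomial.eval z P = 0) → p.eval (z i) = 0 := by
      intro i
      obtain ⟨p, hp, hpe⟩ := hintg (Ideal.Quotient.mk I (MvPolynomial.X i))
      let e : MvPolynomial (Fin 0) ℂ →ₐ[ℂ] ℂ := MvPolynomial.aeval (fun i => i.elim0)
      have he : ∀ a, a = MvPolynomial.C (e a) := by
        intro a
        obtain ⟨c, rfl⟩ := MvPolynomial.C_surjective (Fin 0) a
        simp [e]
      refine ⟨p.map e.toRingHom, (hp.map _).ne_zero, fun z hz => ?_⟩
      let ψ : (MvPolynomial σ ℂ ⧸ I) →ₐ[ℂ] ℂ := Ideal.Quotient.liftₐ I (MvPolynomial.aeval z)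
        (fun a ha => by simpa [MvPolynomial.aeval_eq_eval] using hz a ha)
      have h1 := congrArg ψ hpe
      rw [map_zero] at h1
      rw [Polynomial.eval_map, ← h1]
      change _ = ψ.toRingHom _
      rw [Polynomial.hom_eval₂]
      congr 1
      · ext a
        · simp [e]
        · exact Fin.elim0 ‹_›
      · simp [ψ]
    choose p hp0 hp using hfin
    refine Set.Finite.subset (Set.Finite.pi' (fun i => (p i).rootSet_finite ℂ)) ?_
    intro z hz i
    rw [Polynomial.mem_rootSet]
    exact ⟨hp0 i, by simpa using hp i z hz⟩
  · exfalso
    obtain ⟨Y, hY⟩ := Ideal.Quotient.mk_surjective (φ (MvPolynomial.X ⟨0, hs⟩))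
    have hcomp : IsCompact (Metric.closedBall (0 : σ → ℂ) (max M 0)) := isCompact_closedBall _ _
    obtain ⟨K, hK⟩ := hcomp.exists_bound_of_continuousOn
      (f := fun z => MvPolynomial.eval z Y) (MvPolynomial.continuous_eval Y).continuousOn
    obtain ⟨v, hv⟩ : ∃ v : ℂ, K < ‖v‖ := ⟨((|K| + 1 : ℝ) : ℂ), by
      rw [Complex.norm_real, Real.norm_eq_abs, abs_of_pos (by positivity)]
      linarith [le_abs_self K]⟩
    let ev : MvPolynomial (Fin s) ℂ →ₐ[ℂ] ℂ := MvPolynomial.aeval (fun _ => v)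
    have hmax : (RingHom.ker ev.toRingHom).IsMaximal :=
      RingHom.ker_isMaximal_of_surjective _ (fun c => ⟨MvPolynomial.C c, by simp [ev]⟩)
    let _ := φ.toRingHom.toAlgebra
    have hai : Algebra.IsIntegral (MvPolynomial (Fin s) ℂ) (MvPolynomial σ ℂ ⧸ I) := ⟨hintg⟩
    obtain ⟨Q, hQ, hQc⟩ := Ideal.exists_ideal_over_maximal_of_isIntegral
      (S := MvPolynomial σ ℂ ⧸ I) (RingHom.ker ev.toRingHom) (by
        have : RingHom.ker (algebraMap (MvPolynomial (Fin s) ℂ) (MvPolynomial σ ℂ ⧸ I)) = ⊥ :=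
          (RingHom.injective_iff_ker_eq_bot _).1 hinj
        rw [this]; exact bot_le)
    have hQ' : (Q.comap (Ideal.Quotient.mk I)).IsMaximal :=
      Ideal.comap_isMaximal_of_surjective _ Ideal.Quotient.mk_surjective
    obtain ⟨z, hz⟩ := (MvPolynomial.isMaximal_iff_eq_vanishingIdeal_singleton (K := ℂ)).1 hQ'
    have hmem : ∀ P, P ∈ Q.comap (Ideal.Quotient.mk I) → MvPolynomial.eval z P = 0 := by
      intro P hP
      rw [hz, MvPolynomial.mem_vanishingIdeal_iff] at hP
      simpa [MvPolynomial.aeval_eq_eval] using hP z rfl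
    have hzI : ∀ P ∈ I, MvPolynomial.eval z P = 0 := by
      intro P hP
      apply hmem
      rw [Ideal.mem_comap, Ideal.Quotient.eq_zero_iff_mem.2 hP]
      exact Q.zero_mem
    have hYv : MvPolynomial.eval z (Y - MvPolynomial.C v) = 0 := by
      apply hmem
      rw [Ideal.mem_comap, map_sub, hY]
      have h1 : (MvPolynomial.X ⟨0, hs⟩ - MvPolynomial.C v : MvPolynomial (Fin s) ℂ) ∈
          RingHom.ker ev.toRingHom := by
        rw [RingHom.mem_ker]
        simp [ev]
      rw [← hQc, Ideal.mem_comap] at h1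
      have h2 : algebraMap (MvPolynomial (Fin s) ℂ) (MvPolynomial σ ℂ ⧸ I)
          (MvPolynomial.X ⟨0, hs⟩ - MvPolynomial.C v) =
          φ (MvPolynomial.X ⟨0, hs⟩) - Ideal.Quotient.mk I (MvPolynomial.C v) := by
        change φ (_ - _) = _
        rw [map_sub]
        congr 1
        exact φ.commutes v
      rwa [h2] at h1
    have hb := hK z (by
      rw [mem_closedBall_zero_iff, pi_norm_le_iff_of_nonneg (le_max_right _ _)]
      exact fun i => (hM z hzI i).trans (le_max_left _ _))
    rw [map_sub, MvPolynomial.eval_C, sub_eq_zero] at hYv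
    rw [hYv] at hb
    linarith

/-! ### Singular value decomposition -/

lemma exists_svd (g : Matrix (Fin 3) (Fin 3) ℂ) :
    ∃ U ∈ Matrix.unitaryGroup (Fin 3) ℂ, ∃ V ∈ Matrix.unitaryGroup (Fin 3) ℂ,
    ∃ d : Fin 3 → ℝ, (∀ i, 0 ≤ d i) ∧ Antitone d ∧
      g * V = U * Matrix.diagonal (fun i => (d i : ℂ)) := by
  have hunit : ∀ b : OrthonormalBasis (Fin 3) ℂ (EuclideanSpace ℂ (Fin 3)),
      Matrix.of (fun i j => b j i) ∈ Matrix.unitaryGroup (Fin 3) ℂ := by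
    intro b
    rw [Matrix.mem_unitaryGroup_iff']
    ext i j
    have := orthonormal_iff_ite.1 b.orthonormal i j
    rw [PiLp.inner_apply] at this
    simpa [Matrix.mul_apply, Matrix.one_apply, mul_comm] using this
  let T := Matrix.toEuclideanLin g
  have hS : (LinearMap.adjoint T ∘ₗ T).IsSymmetric := LinearMap.isSymmetric_adjoint_mul_self T
  have hn : Module.finrank ℂ (EuclideanSpace ℂ (Fin 3)) = 3 := by simp
  let b := hS.eigenvectorBasis hn
  have hinner : ∀ i j, inner ℂ (T (b i)) (T (b j)) =
      if i = j then ((hS.eigenvalues hn j : ℝ) : ℂ) else 0 := by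
    intro i j
    rw [← LinearMap.adjoint_inner_right]
    have h1 : (LinearMap.adjoint T) (T (b j)) = ((hS.eigenvalues hn j : ℝ) : ℂ) • b j :=
      hS.apply_eigenvectorBasis hn j
    rw [h1, inner_smul_right, orthonormal_iff_ite.1 b.orthonormal i j]
    split_ifs <;> simp
  have hsq : ∀ i, ‖T (b i)‖ ^ 2 = hS.eigenvalues hn i := by
    intro i
    have h1 := hinner i i
    rw [inner_self_eq_norm_sq_to_K, if_pos rfl] at h1
    have h2 : ((‖T (b i)‖ ^ 2 : ℝ) : ℂ) = ((hS.eigenvalues hn i : ℝ) : ℂ) := by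
      rw [← h1]; push_cast; rfl
    exact Complex.ofReal_injective h2
  let v : Fin 3 → EuclideanSpace ℂ (Fin 3) := fun i => ((‖T (b i)‖⁻¹ : ℝ) : ℂ) • T (b i)
  have hv : Orthonormal ℂ (Set.domRestrict {i | T (b i) ≠ 0} v) := by
    rw [orthonormal_iff_ite]
    rintro ⟨i, hi⟩ ⟨j, hj⟩
    have hi' : ‖T (b i)‖ ≠ 0 := norm_ne_zero_iff.2 hi
    simp only [Set.domRestrict_apply, v, inner_smul_left, inner_smul_right, hinner, Subtype.mk.injEq]
    split_ifs with hij
    · subst hij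
      rw [← hsq]
      have hi2 : ((‖T (b i)‖ : ℝ) : ℂ) ≠ 0 := by exact_mod_cast hi'
      simp
      field_simp
    · simp
  obtain ⟨u, hu⟩ := hv.exists_orthonormalBasis_extension_of_card_eq (by simp)
  refine ⟨_, hunit u, _, hunit b, fun i => ‖T (b i)‖, fun i => norm_nonneg _, ?_, ?_⟩
  · intro i j hij
    have h1 := hS.eigenvalues_antitone hn hij
    rw [← hsq, ← hsq] at h1
    exact (sq_le_sq₀ (norm_nonneg _) (norm_nonneg _)).1 h1
  · ext i j
    rw [Matrix.mul_diagonal]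
    have h1 : (T (b j)) i = ((‖T (b j)‖ : ℝ) : ℂ) * u j i := by
      by_cases h0 : T (b j) = 0
      · simp [h0]
      · rw [hu j h0]
        have : ‖T (b j)‖ ≠ 0 := norm_ne_zero_iff.2 h0
        have : ((‖T (b j)‖ : ℝ) : ℂ) ≠ 0 := by exact_mod_cast this
        simp [v]
        field_simp
    have h2 : (T (b j)) i = (g * Matrix.of (fun i j => b j i)) i j := by
      simp [T, Matrix.mul_apply, Matrix.toLpLin_apply, Matrix.mulVec, dotProduct]
    rw [← h2, h1]
    simp [mul_comm]

/-! ### Finiteness of stabilizers of nodal quartics -/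

/-- Homogeneity as a scaling law. -/
lemma eval_smul_homog {F : MvPolynomial (Fin 3) ℂ} {n : ℕ} (hF : F.IsHomogeneous n) (r : ℂ)
    (x : Fin 3 → ℂ) : MvPolynomial.eval (r • x) F = r ^ n * MvPolynomial.eval x F := by
  rw [MvPolynomial.eval_eq, MvPolynomial.eval_eq, Finset.mul_sum]
  refine Finset.sum_congr rfl fun d hd => ?_
  have hdeg : ∑ i ∈ d.support, d i = n := by
    have := hF (MvPolynomial.mem_support_iff.1 hd)
    rw [← this, ← Finsupp.degree_apply]
    exact DFunLike.congr_fun Finsupp.degree_eq_weight_one d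
  simp only [Pi.smul_apply, smul_eq_mul, mul_pow, Finset.prod_mul_distrib]
  rw [Finset.prod_pow_eq_pow_sum, hdeg]
  ring

lemma isCompact_unitary : IsCompact {U : Matrix (Fin 3) (Fin 3) ℂ |
    U ∈ Matrix.unitaryGroup (Fin 3) ℂ} := by
  have h1 : IsCompact (Set.pi Set.univ (fun _ : Fin 3 => Set.pi Set.univ
      (fun _ : Fin 3 => Metric.closedBall (0 : ℂ) 1))) :=
    isCompact_univ_pi fun _ => isCompact_univ_pi fun _ => isCompact_closedBall _ _
  refine IsCompact.of_isClosed_subset (X := Matrix (Fin 3) (Fin 3) ℂ) h1 ?_ ?_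
  · have : {U : Matrix (Fin 3) (Fin 3) ℂ | U ∈ Matrix.unitaryGroup (Fin 3) ℂ} =
        {U | star U * U = 1} := by
      ext U; exact Matrix.mem_unitaryGroup_iff'
    rw [this]
    exact isClosed_eq (by fun_prop) continuous_const
  · intro U hU i _ j _
    rw [mem_closedBall_zero_iff]
    exact entry_norm_bound_of_unitary hU i j

lemma isUnit_det_of_unitary {U : Matrix (Fin 3) (Fin 3) ℂ}
    (hU : U ∈ Matrix.unitaryGroup (Fin 3) ℂ) : IsUnit U.det := by
  have h := Matrix.mem_unitaryGroup_iff.1 hU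
  have := congrArg Matrix.det h
  rw [Matrix.det_mul, Matrix.det_one] at this
  exact IsUnit.of_mul_eq_one _ this

lemma continuous_coeff_transform (F : MvPolynomial (Fin 3) ℂ) : ∀ m : Fin 3 →₀ ℕ,
    Continuous (fun U : Matrix (Fin 3) (Fin 3) ℂ => MvPolynomial.coeff m (transformPoly U F)) := by
  classical
  unfold transformPoly
  induction F using MvPolynomial.induction_on with
  | C a => intro m; simpa using continuous_const
  | add p q hp hq =>
    intro m
    simp only [map_add, MvPolynomial.coeff_add]
    exact (hp m).add (hq m)
  | mul_X p i hp =>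
    intro m
    simp only [map_mul, MvPolynomial.aeval_X, Finset.mul_sum, MvPolynomial.coeff_sum]
    refine continuous_finsetSum _ fun j _ => ?_
    have : ∀ U : Matrix (Fin 3) (Fin 3) ℂ, MvPolynomial.coeff m ((MvPolynomial.aeval
        fun i => ∑ j, MvPolynomial.C (U i j) * MvPolynomial.X j) p *
          (MvPolynomial.C (U i j) * MvPolynomial.X j)) =
        if j ∈ m.support then U i j * MvPolynomial.coeff (m - Finsupp.single j 1)
          ((MvPolynomial.aeval fun i => ∑ j, MvPolynomial.C (U i j) * MvPolynomial.X j) p)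
        else 0 := by
      intro U
      rw [← mul_assoc, MvPolynomial.coeff_mul_X', mul_comm, MvPolynomial.coeff_C_mul]
    simp only [this]
    split_ifs
    · exact (continuous_apply_apply i j).mul (hp _)
    · exact continuous_const

lemma coeff_transform_diagonal (d : Fin 3 → ℂ) (T : MvPolynomial (Fin 3) ℂ) (m : Fin 3 →₀ ℕ) :
    MvPolynomial.coeff m (transformPoly (Matrix.diagonal d) T) =
      (∏ i, d i ^ m i) * MvPolynomial.coeff m T := by
  classical
  have hf : (fun i => ∑ j, MvPolynomial.C (Matrix.diagonal d i j) * MvPolynomial.X j :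
      Fin 3 → MvPolynomial (Fin 3) ℂ) = fun i => MvPolynomial.C (d i) * MvPolynomial.X i := by
    funext i
    rw [Finset.sum_eq_single i]
    · simp
    · intro b _ hb; simp [Matrix.diagonal_apply_ne _ (Ne.symm hb)]
    · simp
  unfold transformPoly
  rw [hf]
  induction T using MvPolynomial.induction_on' with
  | add p q hp hq => simp only [map_add, MvPolynomial.coeff_add, hp, hq, mul_add]
  | monomial n a =>
    have h1 : MvPolynomial.aeval (fun i => MvPolynomial.C (d i) * MvPolynomial.X i :
        Fin 3 → MvPolynomial (Fin 3) ℂ) (MvPolynomial.monomial n a) =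
        MvPolynomial.C (∏ i, d i ^ n i) * MvPolynomial.monomial n a := by
      rw [MvPolynomial.aeval_monomial, MvPolynomial.monomial_eq, Finsupp.prod_fintype _ _ (by simp),
        Finsupp.prod_fintype _ _ (by simp)]
      simp only [mul_pow, Finset.prod_mul_distrib, map_prod, map_pow, MvPolynomial.algebraMap_eq]
      ring
    rw [h1, MvPolynomial.coeff_C_mul, MvPolynomial.coeff_monomial]
    split_ifs with h
    · rw [h]
    · simp

lemma exists_lower_bound {F : MvPolynomial (Fin 3) ℂ} (hF : F.IsHomogeneous 4) (hN : Nodal F)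
    (k i j : Fin 3) (hki : k ≠ i) (hkj : k ≠ j) (hij : i ≠ j) :
    ∃ δ : ℝ, 0 < δ ∧ ∀ U ∈ Matrix.unitaryGroup (Fin 3) ℂ,
      ∃ m ∈ [Finsupp.single k 4, Finsupp.single k 3 + Finsupp.single i 1,
        Finsupp.single k 3 + Finsupp.single j 1,
        Finsupp.single k 2 + Finsupp.single i 1 + Finsupp.single j 1,
        Finsupp.single k 2 + Finsupp.single i 1 + Finsupp.single i 1],
      δ ≤ ‖MvPolynomial.coeff m (transformPoly U F)‖ := by
  let c : (Fin 3 →₀ ℕ) → Matrix (Fin 3) (Fin 3) ℂ → ℝ := fun m U =>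
    ‖MvPolynomial.coeff m (transformPoly U F)‖
  have hcc : ∀ m, Continuous (c m) := fun m => (continuous_coeff_transform F m).norm
  have hc0 : ∀ m U, 0 ≤ c m U := fun m U => norm_nonneg _
  let ψ : Matrix (Fin 3) (Fin 3) ℂ → ℝ := fun U => c (Finsupp.single k 4) U +
    c (Finsupp.single k 3 + Finsupp.single i 1) U + c (Finsupp.single k 3 + Finsupp.single j 1) U +
    c (Finsupp.single k 2 + Finsupp.single i 1 + Finsupp.single j 1) U +
    c (Finsupp.single k 2 + Finsupp.single i 1 + Finsupp.single i 1) U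
  have hψ : Continuous ψ :=
    ((((hcc _).add (hcc _)).add (hcc _)).add (hcc _)).add (hcc _)
  obtain ⟨U₀, hU₀, hmin⟩ := isCompact_unitary.exists_isMinOn
    ⟨1, (Matrix.unitaryGroup (Fin 3) ℂ).one_mem⟩ hψ.continuousOn
  have hpos : 0 < ψ U₀ := by
    by_contra hneg
    have hsum : c (Finsupp.single k 4) U₀ +
      c (Finsupp.single k 3 + Finsupp.single i 1) U₀ +
      c (Finsupp.single k 3 + Finsupp.single j 1) U₀ +
      c (Finsupp.single k 2 + Finsupp.single i 1 + Finsupp.single j 1) U₀ +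
      c (Finsupp.single k 2 + Finsupp.single i 1 + Finsupp.single i 1) U₀ ≤ 0 := not_lt.1 hneg
    have h1 := hc0 (Finsupp.single k 4) U₀
    have h2 := hc0 (Finsupp.single k 3 + Finsupp.single i 1) U₀
    have h3 := hc0 (Finsupp.single k 3 + Finsupp.single j 1) U₀
    have h4 := hc0 (Finsupp.single k 2 + Finsupp.single i 1 + Finsupp.single j 1) U₀
    have h5 := hc0 (Finsupp.single k 2 + Finsupp.single i 1 + Finsupp.single i 1) U₀
    exact (hN.transform (isUnit_det_of_unitary hU₀)).vertex (transformPoly_homog _ hF)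
      k i j hki hkj hij
      (norm_eq_zero.1 (le_antisymm (by change c _ U₀ ≤ 0; linarith) (norm_nonneg _)))
      (norm_eq_zero.1 (le_antisymm (by change c _ U₀ ≤ 0; linarith) (norm_nonneg _)))
      (norm_eq_zero.1 (le_antisymm (by change c _ U₀ ≤ 0; linarith) (norm_nonneg _)))
      (norm_eq_zero.1 (le_antisymm (by change c _ U₀ ≤ 0; linarith) (norm_nonneg _)))
      (norm_eq_zero.1 (le_antisymm (by change c _ U₀ ≤ 0; linarith) (norm_nonneg _)))
  refine ⟨ψ U₀ / 5, by positivity, fun U hU => ?_⟩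
  have hle : ψ U₀ ≤ ψ U := hmin hU
  by_contra hcon
  push Not at hcon
  have e1 : c _ U < _ := hcon (Finsupp.single k 4) (by simp)
  have e2 : c _ U < _ := hcon (Finsupp.single k 3 + Finsupp.single i 1) (by simp)
  have e3 : c _ U < _ := hcon (Finsupp.single k 3 + Finsupp.single j 1) (by simp)
  have e4 : c _ U < _ :=
    hcon (Finsupp.single k 2 + Finsupp.single i 1 + Finsupp.single j 1) (by simp)
  have e5 : c _ U < _ :=
    hcon (Finsupp.single k 2 + Finsupp.single i 1 + Finsupp.single i 1) (by simp)
  have : ψ U < ψ U₀ := by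
    change c _ U + c _ U + c _ U + c _ U + c _ U < _
    linarith
  linarith

lemma exists_upper_bound (F : MvPolynomial (Fin 3) ℂ) (l : List (Fin 3 →₀ ℕ)) :
    ∃ M : ℝ, 0 < M ∧ ∀ U ∈ Matrix.unitaryGroup (Fin 3) ℂ, ∀ m ∈ l,
      ‖MvPolynomial.coeff m (transformPoly U F)‖ ≤ M := by
  induction l with
  | nil => exact ⟨1, one_pos, by simp⟩
  | cons a l ih =>
    obtain ⟨M, hM, h⟩ := ih
    obtain ⟨K, hK⟩ := isCompact_unitary.exists_bound_of_continuousOn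
      (continuous_coeff_transform F a).continuousOn
    refine ⟨max M K, lt_of_lt_of_le hM (le_max_left _ _), fun U hU m hm => ?_⟩
    rcases List.mem_cons.1 hm with rfl | hm
    · exact (hK U hU).trans (le_max_right _ _)
    · exact (h U hU m hm).trans (le_max_left _ _)

lemma real_bound {a b c C : ℝ} (hc : 0 ≤ c) (hcb : c ≤ b) (hba : b ≤ a)
    (hC : 0 < C) (h1 : a ^ 2 * b * c ≤ C) (h2 : 1 ≤ a * b * c ^ 2 * C) : a ≤ 1 + C ^ 5 := by
  have hb : 0 ≤ b := hc.trans hcb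
  have ha : 0 ≤ a := hb.trans hba
  have hapos : 0 < a := by
    rcases ha.eq_or_lt with h | h
    · rw [← h] at h2; norm_num at h2
    · exact h
  -- `a ≤ c C²`
  have h3 : a ≤ c * C ^ 2 := by
    have : a * (a * b * c ^ 2 * C) = (a ^ 2 * b * c) * (c * C) := by ring
    have h4 : a ≤ a * (a * b * c ^ 2 * C) := le_mul_of_one_le_right ha h2
    rw [this] at h4
    have h5 : (a ^ 2 * b * c) * (c * C) ≤ C * (c * C) :=
      mul_le_mul_of_nonneg_right h1 (by positivity)
    nlinarith
  have h6 : a ^ 4 ≤ C ^ 5 := by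
    have e1 : a ^ 2 ≤ (c * C ^ 2) ^ 2 := pow_le_pow_left₀ ha h3 2
    have e2 : a ^ 2 * c ^ 2 ≤ C := by
      refine le_trans ?_ h1
      have : a ^ 2 * c ^ 2 = a ^ 2 * (c * c) := by ring
      rw [this, mul_assoc]
      gcongr
    calc a ^ 4 = a ^ 2 * a ^ 2 := by ring
      _ ≤ a ^ 2 * (c * C ^ 2) ^ 2 := by gcongr
      _ = (a ^ 2 * c ^ 2) * C ^ 4 := by ring
      _ ≤ C * C ^ 4 := by gcongr
      _ = C ^ 5 := by ring
  by_cases h1a : a ≤ 1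
  · have : 0 < C ^ 5 := by positivity
    linarith
  · have : a ≤ a ^ 4 := le_self_pow₀ (not_le.1 h1a).le (by norm_num)
    linarith

lemma Nodal.stab_bounded {F : MvPolynomial (Fin 3) ℂ} (hF : F.IsHomogeneous 4) (hN : Nodal F) :
    ∃ M : ℝ, ∀ g : Matrix (Fin 3) (Fin 3) ℂ, transformPoly g F = F → ∀ i j, ‖g i j‖ ≤ M := by
  obtain ⟨δ₁, hδ₁, hl₁⟩ := exists_lower_bound hF hN 0 1 2 (by decide) (by decide) (by decide)
  obtain ⟨δ₂, hδ₂, hl₂⟩ := exists_lower_bound hF hN 2 1 0 (by decide) (by decide) (by decide)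
  set l₁ : List (Fin 3 →₀ ℕ) := [Finsupp.single 0 4, Finsupp.single 0 3 + Finsupp.single 1 1,
        Finsupp.single 0 3 + Finsupp.single 2 1,
        Finsupp.single 0 2 + Finsupp.single 1 1 + Finsupp.single 2 1,
        Finsupp.single 0 2 + Finsupp.single 1 1 + Finsupp.single 1 1] with hl₁def
  set l₂ : List (Fin 3 →₀ ℕ) := [Finsupp.single 2 4, Finsupp.single 2 3 + Finsupp.single 1 1,
        Finsupp.single 2 3 + Finsupp.single 0 1,
        Finsupp.single 2 2 + Finsupp.single 1 1 + Finsupp.single 0 1,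
        Finsupp.single 2 2 + Finsupp.single 1 1 + Finsupp.single 1 1] with hl₂def
  obtain ⟨M, hM, hu⟩ := exists_upper_bound F (l₁ ++ l₂)
  set C : ℝ := M / min δ₁ δ₂ with hC
  have hδ : 0 < min δ₁ δ₂ := lt_min hδ₁ hδ₂
  have hCpos : 0 < C := by positivity
  refine ⟨3 * (1 + C ^ 5), fun g hg => ?_⟩
  obtain ⟨U, hU, V, hV, d, hd0, hda, hgV⟩ := exists_svd g
  have hcoef : ∀ m : Fin 3 →₀ ℕ, (d 0 ^ m 0 * d 1 ^ m 1 * d 2 ^ m 2) *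
      ‖MvPolynomial.coeff m (transformPoly U F)‖ = ‖MvPolynomial.coeff m (transformPoly V F)‖ := by
    intro m
    have h1 : transformPoly (g * V) F = transformPoly V F := by rw [transformPoly_mul, hg]
    rw [hgV, transformPoly_mul] at h1
    rw [← h1, coeff_transform_diagonal, norm_mul, Fin.prod_univ_three]
    simp [abs_of_nonneg (hd0 _)]
  have h01 : d 1 ≤ d 0 := hda (by decide)
  have h12 : d 2 ≤ d 1 := hda (by decide)
  have h02 : d 2 ≤ d 0 := h12.trans h01
  have p0 := hd0 0
  have p1 := hd0 1
  have p2 := hd0 2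
  have hd : d 0 ≤ 1 + C ^ 5 := by
    apply real_bound p2 h12 h01 hCpos
    · obtain ⟨m, hm, hmδ⟩ := hl₁ U hU
      have hub := hu V hV m (List.mem_append_left _ hm)
      rw [← hcoef] at hub
      have hge : d 0 ^ 2 * d 1 * d 2 ≤ d 0 ^ m 0 * d 1 ^ m 1 * d 2 ^ m 2 := by
        rw [hl₁def] at hm
        simp only [List.mem_cons, List.not_mem_nil, or_false] at hm
        rcases hm with rfl | rfl | rfl | rfl | rfl <;> simp [Finsupp.single_apply]
        · calc d 0 ^ 2 * d 1 * d 2 ≤ d 0 ^ 2 * d 0 * d 0 := by gcongr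
            _ = d 0 ^ 4 := by ring
        · calc d 0 ^ 2 * d 1 * d 2 ≤ d 0 ^ 2 * d 1 * d 0 := by gcongr
            _ = d 0 ^ 3 * d 1 := by ring
        · calc d 0 ^ 2 * d 1 * d 2 ≤ d 0 ^ 2 * d 0 * d 2 := by gcongr
            _ = d 0 ^ 3 * d 2 := by ring
        · calc d 0 ^ 2 * d 1 * d 2 ≤ d 0 ^ 2 * d 1 * d 1 := by gcongr
            _ = d 0 ^ 2 * d 1 ^ 2 := by ring
      rw [hC, le_div_iff₀ hδ]
      refine le_trans ?_ hub
      have : min δ₁ δ₂ ≤ ‖MvPolynomial.coeff m (transformPoly U F)‖ := (min_le_left _ _).trans hmδ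
      gcongr
    · obtain ⟨m, hm, hmδ⟩ := hl₂ V hV
      have hub := hu U hU m (List.mem_append_right _ hm)
      rw [← hcoef] at hmδ
      have hge : d 0 ^ m 0 * d 1 ^ m 1 * d 2 ^ m 2 ≤ d 0 * d 1 * d 2 ^ 2 := by
        rw [hl₂def] at hm
        simp only [List.mem_cons, List.not_mem_nil, or_false] at hm
        rcases hm with rfl | rfl | rfl | rfl | rfl <;> simp [Finsupp.single_apply]
        · calc d 2 ^ 4 = d 2 * d 2 * d 2 ^ 2 := by ring
            _ ≤ d 0 * d 1 * d 2 ^ 2 := by gcongr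
        · calc d 1 * d 2 ^ 3 = d 2 * d 1 * d 2 ^ 2 := by ring
            _ ≤ d 0 * d 1 * d 2 ^ 2 := by gcongr
        · calc d 0 * d 2 ^ 3 = d 0 * d 2 * d 2 ^ 2 := by ring
            _ ≤ d 0 * d 1 * d 2 ^ 2 := by gcongr
        · calc d 1 ^ 2 * d 2 ^ 2 = d 1 * d 1 * d 2 ^ 2 := by ring
            _ ≤ d 0 * d 1 * d 2 ^ 2 := by gcongr
      have h3 : min δ₁ δ₂ ≤ d 0 * d 1 * d 2 ^ 2 * M := by
        refine (min_le_right _ _).trans (hmδ.trans ?_)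
        gcongr
      rw [hC, ← mul_div_assoc, le_div_iff₀ hδ]
      linarith
  intro i j
  have hgeq : g = U * Matrix.diagonal (fun i => (d i : ℂ)) * star V := by
    rw [← hgV, mul_assoc, Matrix.mem_unitaryGroup_iff.1 hV, mul_one]
  rw [hgeq, Matrix.mul_apply]
  refine (norm_sum_le _ _).trans ?_
  have hterm : ∀ k ∈ Finset.univ, ‖(U * Matrix.diagonal (fun i => (d i : ℂ))) i k * (star V) k j‖
      ≤ 1 + C ^ 5 := by
    intro k _
    rw [Matrix.mul_diagonal, norm_mul, norm_mul, Matrix.star_apply, norm_star, Complex.norm_real,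
      Real.norm_of_nonneg (hd0 k)]
    have hk : d k ≤ d 0 := hda (Fin.zero_le k)
    calc ‖U i k‖ * d k * ‖V j k‖ ≤ 1 * (1 + C ^ 5) * 1 := by
          have e1 := entry_norm_bound_of_unitary hU i k
          have e2 := entry_norm_bound_of_unitary hV j k
          have e3 := hd0 k
          have e4 := hk.trans hd
          gcongr
      _ = _ := by ring
  refine (Finset.sum_le_sum hterm).trans ?_
  simp
  linarith

lemma Nodal.stab_finite {F : MvPolynomial (Fin 3) ℂ} (hF : F.IsHomogeneous 4) (hN : Nodal F) :
    {g : Matrix (Fin 3) (Fin 3) ℂ | transformPoly g F = F}.Finite := by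
  obtain ⟨M, hM⟩ := hN.stab_bounded hF
  let P : (Fin 3 → ℂ) → MvPolynomial (Fin 3 × Fin 3) ℂ := fun x =>
    MvPolynomial.aeval (fun i => ∑ j, MvPolynomial.X (i, j) * MvPolynomial.C (x j)) F
      - MvPolynomial.C (MvPolynomial.eval x F)
  let I : Ideal (MvPolynomial (Fin 3 × Fin 3) ℂ) := Ideal.span (Set.range P)
  have hP : ∀ (z : Fin 3 × Fin 3 → ℂ) x, MvPolynomial.eval z (P x) =
      MvPolynomial.eval x (transformPoly (Matrix.of fun i j => z (i, j)) F)
        - MvPolynomial.eval x F := by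
    intro z x
    simp only [P, map_sub, MvPolynomial.eval_C, eval_transformPoly]
    congr 1
    generalize F = G
    induction G using MvPolynomial.induction_on with
    | C a => simp
    | add p q hp hq => simp only [map_add, hp, hq]
    | mul_X p i hp =>
      simp only [map_mul, hp, MvPolynomial.aeval_X, MvPolynomial.eval_X]
      congr 1
      simp [Matrix.mulVec, dotProduct]
  have hz : ∀ z : Fin 3 × Fin 3 → ℂ, (∀ p ∈ I, MvPolynomial.eval z p = 0) ↔
      transformPoly (Matrix.of fun i j => z (i, j)) F = F := by
    intro z
    constructor
    · intro h
      apply MvPolynomial.funext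
      intro x
      have := h (P x) (Ideal.subset_span ⟨x, rfl⟩)
      rw [hP] at this
      exact sub_eq_zero.1 this
    · intro h p hp
      have hle : I ≤ RingHom.ker (MvPolynomial.eval z) := by
        rw [Ideal.span_le]
        rintro _ ⟨x, rfl⟩
        change MvPolynomial.eval z (P x) = 0
        rw [hP, h, sub_self]
      exact hle hp
  have hfin := finite_of_bounded I M (fun z h i => hM _ ((hz z).1 h) i.1 i.2)
  refine (hfin.image (fun z => (Matrix.of fun i j => z (i, j) :
    Matrix (Fin 3) (Fin 3) ℂ))).subset ?_
  intro g hg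
  exact ⟨fun q => g q.1 q.2, (hz _).2 hg, rfl⟩

lemma transformPoly_smul (r : ℂ) (g : Matrix (Fin 3) (Fin 3) ℂ) {F : MvPolynomial (Fin 3) ℂ}
    (hF : F.IsHomogeneous 4) : transformPoly (r • g) F = r ^ 4 • transformPoly g F := by
  apply MvPolynomial.funext
  intro x
  have h1 : (r • g).mulVec x = r • g.mulVec x := Matrix.smul_mulVec _ _ _
  rw [eval_transformPoly, h1, MvPolynomial.smul_eval, eval_transformPoly]
  exact eval_smul_homog hF r _

lemma Nodal.projStabFinite {F : MvPolynomial (Fin 3) ℂ} (hF : F.IsHomogeneous 4) (hN : Nodal F) :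
    ProjStabFinite F := by
  refine ⟨_, hN.stab_finite hF, ?_⟩
  rintro g ⟨c, hc, hg⟩
  obtain ⟨r, hr⟩ := IsAlgClosed.exists_pow_nat_eq c (n := 4) (by norm_num)
  have hr0 : r ≠ 0 := by rintro rfl; apply hc; rw [← hr]; norm_num
  refine ⟨r⁻¹ • (g : Matrix (Fin 3) (Fin 3) ℂ), ?_, r, hr0, by simp [smul_smul, hr0]⟩
  change transformPoly _ F = F
  rw [transformPoly_smul _ _ hF, hg, ← hr, smul_smul, inv_pow, inv_mul_cancel₀ (pow_ne_zero _ hr0),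
    one_smul]

lemma Nodal.memV {F : MvPolynomial (Fin 3) ℂ} (hF : F.IsHomogeneous 4) (hN : Nodal F) :
    memV F :=
  ⟨hF, hN.squarefree hF, hN.semistable hF, hN.projStabFinite hF⟩

/-! ### Openness of nodality -/

lemma singAt_smul {F : MvPolynomial (Fin 3) ℂ} {n : ℕ} (hF : F.IsHomogeneous n) (r : ℂ)
    (x : Fin 3 → ℂ) (h : MvPolynomial.eval x F = 0) : MvPolynomial.eval (r • x) F = 0 := by
  rw [eval_smul_homog hF, h, mul_zero]

/-- A polynomial arc of quartics through a nodal one is nodal for small parameter. -/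
lemma Nodal.eventually {F G H K : MvPolynomial (Fin 3) ℂ} (hF : F.IsHomogeneous 4)
    (hG : G.IsHomogeneous 4) (hH : H.IsHomogeneous 4) (hK : K.IsHomogeneous 4) (hN : Nodal F) :
    ∀ᶠ s in nhds (0 : ℂ), Nodal (F + s • G + s ^ 2 • H + s ^ 3 • K) := by
  let Γ : ℂ → MvPolynomial (Fin 3) ℂ := fun s => F + s • G + s ^ 2 • H + s ^ 3 • K
  have hsm : ∀ (c : ℂ) {P : MvPolynomial (Fin 3) ℂ}, P.IsHomogeneous 4 →
      (c • P).IsHomogeneous 4 := fun c P hP => by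
    rw [MvPolynomial.smul_eq_C_mul]
    simpa using (isHomogeneous_C (Fin 3) c).mul hP
  have hΓ : ∀ s, (Γ s).IsHomogeneous 4 := fun s =>
    ((hF.add (hsm _ hG)).add (hsm _ hH)).add (hsm _ hK)
  have c0 : Continuous (fun z : ℂ × (Fin 3 → ℂ) => MvPolynomial.eval z.2 (Γ z.1)) := by
    simp only [Γ, map_add, MvPolynomial.smul_eval]
    have := fun P : MvPolynomial (Fin 3) ℂ => (MvPolynomial.continuous_eval P).comp
      (continuous_snd (X := ℂ) (Y := Fin 3 → ℂ))
    have hcf : Continuous (fun z : ℂ × (Fin 3 → ℂ) => z.1) := continuous_fst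
    exact (((this F).add (hcf.mul (this G))).add ((hcf.pow 2).mul (this H))).add
      ((hcf.pow 3).mul (this K))
  have c1 : ∀ i, Continuous (fun z : ℂ × (Fin 3 → ℂ) =>
      MvPolynomial.eval z.2 (pderiv i (Γ z.1))) := by
    intro i
    simp only [Γ, map_add, Derivation.map_smul, MvPolynomial.smul_eval]
    have := fun P : MvPolynomial (Fin 3) ℂ => (MvPolynomial.continuous_eval P).comp
      (continuous_snd (X := ℂ) (Y := Fin 3 → ℂ))
    have hcf : Continuous (fun z : ℂ × (Fin 3 → ℂ) => z.1) := continuous_fst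
    exact (((this _).add (hcf.mul (this _))).add ((hcf.pow 2).mul (this _))).add
      ((hcf.pow 3).mul (this _))
  have c2 : ∀ i j, Continuous (fun z : ℂ × (Fin 3 → ℂ) => hessMat (Γ z.1) z.2 i j) := by
    intro i j
    simp only [hessMat, Matrix.of_apply, Γ, map_add, Derivation.map_smul, MvPolynomial.smul_eval]
    have := fun P : MvPolynomial (Fin 3) ℂ => (MvPolynomial.continuous_eval P).comp
      (continuous_snd (X := ℂ) (Y := Fin 3 → ℂ))
    have hcf : Continuous (fun z : ℂ × (Fin 3 → ℂ) => z.1) := continuous_fst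
    exact (((this _).add (hcf.mul (this _))).add ((hcf.pow 2).mul (this _))).add
      ((hcf.pow 3).mul (this _))
  have hΓ0 : Γ 0 = F := by simp [Γ]
  have key : ∀ᶠ s in nhds (0 : ℂ), ∀ x ∈ Metric.sphere (0 : Fin 3 → ℂ) 1,
      SingAt (Γ s) x → ∃ i j k l, hessMat (Γ s) x i k * hessMat (Γ s) x j l
        - hessMat (Γ s) x i l * hessMat (Γ s) x j k ≠ 0 := by
    apply (isCompact_sphere (0 : Fin 3 → ℂ) 1).eventually_forall_of_forall_eventually
    intro y hy
    have hy0 : y ≠ 0 := by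
      rintro rfl; simp at hy
    by_cases e0 : MvPolynomial.eval y F = 0
    · by_cases e1 : ∀ i, MvPolynomial.eval y (pderiv i F) = 0
      · obtain ⟨i, j, k, l, hm⟩ := (nodal_iff hF).1 hN y hy0 ⟨e0, e1⟩
        have hc : Continuous (fun z : ℂ × (Fin 3 → ℂ) =>
            hessMat (Γ z.1) z.2 i k * hessMat (Γ z.1) z.2 j l
              - hessMat (Γ z.1) z.2 i l * hessMat (Γ z.1) z.2 j k) :=
          ((c2 i k).mul (c2 j l)).sub ((c2 i l).mul (c2 j k))
        have := hc.continuousAt.eventually_ne (x := ((0 : ℂ), y)) (y := 0)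
          (by simpa only [hΓ0] using hm)
        filter_upwards [this] with z hz _
        exact ⟨i, j, k, l, hz⟩
      · push Not at e1
        obtain ⟨i, hi⟩ := e1
        have := (c1 i).continuousAt.eventually_ne (x := ((0 : ℂ), y)) (y := 0)
          (by simpa only [hΓ0] using hi)
        filter_upwards [this] with z hz hs
        exact absurd (hs.2 i) hz
    · have := c0.continuousAt.eventually_ne (x := ((0 : ℂ), y)) (y := 0)
          (by simpa only [hΓ0] using e0)
      filter_upwards [this] with z hz hs
      exact absurd hs.1 hz
  filter_upwards [key] with s hs
  rw [nodal_iff (hΓ s)]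
  intro x hx hsing
  have hnx : ‖x‖ ≠ 0 := norm_ne_zero_iff.2 hx
  set r : ℂ := ((‖x‖⁻¹ : ℝ) : ℂ) with hr
  have hr0 : r ≠ 0 := by rw [hr]; exact_mod_cast inv_ne_zero hnx
  obtain ⟨i, j, k, l, hm⟩ := hs (r • x) (by
    rw [mem_sphere_zero_iff_norm, norm_smul, hr, Complex.norm_real, norm_inv, norm_norm,
      inv_mul_cancel₀ hnx])
    ⟨singAt_smul (hΓ s) r x hsing.1, fun i => singAt_smul (hΓ s).pderiv r x (hsing.2 i)⟩
  refine ⟨i, j, k, l, fun h0 => hm ?_⟩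
  have hh : ∀ a b, hessMat (Γ s) (r • x) a b = r ^ 2 * hessMat (Γ s) x a b := by
    intro a b
    exact eval_smul_homog ((hΓ s).pderiv (i := b)).pderiv r x
  simp only [hh]
  linear_combination r ^ 4 * h0

/-! ### First-order calculus on the space of quartics -/

lemma coeffEval_arc (Φ : MvPolynomial (Fin 3 →₀ ℕ) ℂ) (F G H K : MvPolynomial (Fin 3) ℂ) (s : ℂ) :
    Polynomial.eval s (MvPolynomial.aeval (fun d => Polynomial.C (F.coeff d)
      + Polynomial.C (G.coeff d) * Polynomial.X + Polynomial.C (H.coeff d) * Polynomial.X ^ 2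
      + Polynomial.C (K.coeff d) * Polynomial.X ^ 3) Φ) =
    coeffEval Φ (F + s • G + s ^ 2 • H + s ^ 3 • K) := by
  unfold coeffEval
  induction Φ using MvPolynomial.induction_on with
  | C a => simp
  | add p q hp hq => simp only [map_add, Polynomial.eval_add, hp, hq]
  | mul_X p d hp =>
    simp only [map_mul, Polynomial.eval_mul, hp, MvPolynomial.aeval_X, MvPolynomial.eval_X]
    congr 1
    simp
    ring

lemma coeffEval_line (Φ : MvPolynomial (Fin 3 →₀ ℕ) ℂ) (F G : MvPolynomial (Fin 3) ℂ) :
    Polynomial.eval 0 (MvPolynomial.aeval (fun d => Polynomial.C (F.coeff d)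
      + Polynomial.C (G.coeff d) * Polynomial.X) Φ) = coeffEval Φ F := by
  have := coeffEval_arc Φ F G 0 0 0
  simpa using this

lemma derivEval_C (a : ℂ) (F G : MvPolynomial (Fin 3) ℂ) :
    derivEval (MvPolynomial.C a) F G = 0 := by
  simp [derivEval]

lemma derivEval_X (d : Fin 3 →₀ ℕ) (F G : MvPolynomial (Fin 3) ℂ) :
    derivEval (MvPolynomial.X d) F G = G.coeff d := by
  simp [derivEval]

lemma derivEval_add (Φ Ψ : MvPolynomial (Fin 3 →₀ ℕ) ℂ) (F G : MvPolynomial (Fin 3) ℂ) :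
    derivEval (Φ + Ψ) F G = derivEval Φ F G + derivEval Ψ F G := by
  simp [derivEval]

lemma derivEval_mul (Φ Ψ : MvPolynomial (Fin 3 →₀ ℕ) ℂ) (F G : MvPolynomial (Fin 3) ℂ) :
    derivEval (Φ * Ψ) F G = derivEval Φ F G * coeffEval Ψ F + coeffEval Φ F * derivEval Ψ F G := by
  rw [← coeffEval_line Φ F G, ← coeffEval_line Ψ F G]
  simp only [derivEval, map_mul, Polynomial.derivative_mul, Polynomial.eval_add,
    Polynomial.eval_mul]

lemma coeffEval_add (Φ Ψ : MvPolynomial (Fin 3 →₀ ℕ) ℂ) (F : MvPolynomial (Fin 3) ℂ) :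
    coeffEval (Φ + Ψ) F = coeffEval Φ F + coeffEval Ψ F := map_add _ _ _

lemma coeffEval_mul (Φ Ψ : MvPolynomial (Fin 3 →₀ ℕ) ℂ) (F : MvPolynomial (Fin 3) ℂ) :
    coeffEval (Φ * Ψ) F = coeffEval Φ F * coeffEval Ψ F := map_mul _ _ _

lemma coeffEval_C (a : ℂ) (F : MvPolynomial (Fin 3) ℂ) :
    coeffEval (MvPolynomial.C a) F = a := MvPolynomial.eval_C _

lemma derivEval_linear (Φ : MvPolynomial (Fin 3 →₀ ℕ) ℂ) (F G G' : MvPolynomial (Fin 3) ℂ)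
    (c : ℂ) : derivEval Φ F (G + c • G') = derivEval Φ F G + c * derivEval Φ F G' := by
  induction Φ using MvPolynomial.induction_on with
  | C a => simp [derivEval_C]
  | add p q hp hq => simp only [derivEval_add, hp, hq]; ring
  | mul_X p d hp =>
    simp only [derivEval_mul, derivEval_X, hp, MvPolynomial.coeff_add, MvPolynomial.coeff_smul,
      smul_eq_mul]
    ring

lemma derivEval_arc (Φ : MvPolynomial (Fin 3 →₀ ℕ) ℂ) (F G H K : MvPolynomial (Fin 3) ℂ) :
    Polynomial.eval 0 (Polynomial.derivative (MvPolynomial.aeval (fun d => Polynomial.C (F.coeff d)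
      + Polynomial.C (G.coeff d) * Polynomial.X + Polynomial.C (H.coeff d) * Polynomial.X ^ 2
      + Polynomial.C (K.coeff d) * Polynomial.X ^ 3) Φ)) = derivEval Φ F G := by
  induction Φ using MvPolynomial.induction_on with
  | C a => simp [derivEval_C]
  | add p q hp hq =>
    simp only [map_add, Polynomial.eval_add, Polynomial.derivative_add, hp, hq, derivEval_add]
  | mul_X p d hp =>
    rw [derivEval_mul, derivEval_X, map_mul, Polynomial.derivative_mul, Polynomial.eval_add,
      Polynomial.eval_mul, Polynomial.eval_mul, hp, coeffEval_arc p, MvPolynomial.aeval_X]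
    simp [coeffEval]

/-- Curve lemma: an equation vanishing along a polynomial arc through `F` has vanishing value
and vanishing derivative along the velocity. -/
lemma curve_lemma (Φ : MvPolynomial (Fin 3 →₀ ℕ) ℂ) (F G H K : MvPolynomial (Fin 3) ℂ)
    (h : ∀ᶠ s in nhdsWithin (0 : ℂ) {0}ᶜ, coeffEval Φ (F + s • G + s ^ 2 • H + s ^ 3 • K) = 0) :
    coeffEval Φ F = 0 ∧ derivEval Φ F G = 0 := by
  set P : Polynomial ℂ := MvPolynomial.aeval (fun d => Polynomial.C (F.coeff d)
      + Polynomial.C (G.coeff d) * Polynomial.X + Polynomial.C (H.coeff d) * Polynomial.X ^ 2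
      + Polynomial.C (K.coeff d) * Polynomial.X ^ 3) Φ with hP
  have hP0 : P = 0 := by
    apply Polynomial.eq_zero_of_infinite_isRoot
    intro hfin
    have h1 : insert (0 : ℂ) {s | P.IsRoot s} ∈ nhds (0 : ℂ) := by
      rw [eventually_nhdsWithin_iff] at h
      filter_upwards [h] with s hs
      by_cases h0 : s = 0
      · exact Or.inl h0
      · right
        change Polynomial.eval s P = 0
        rw [hP, coeffEval_arc]
        exact hs h0
    exact infinite_of_mem_nhds _ h1 (hfin.insert 0)
  constructor
  · have := coeffEval_arc Φ F G H K 0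
    rw [← hP, hP0] at this
    simpa using this.symm
  · rw [← derivEval_arc Φ F G H K, ← hP, hP0]; simp

lemma vanish_closure {S : Set (MvPolynomial (Fin 3) ℂ)} {Φ : MvPolynomial (Fin 3 →₀ ℕ) ℂ}
    (h : ∀ H ∈ S, coeffEval Φ H = 0) : ∀ H ∈ ZarClosure S, coeffEval Φ H = 0 :=
  fun _ hH => hH Φ h

lemma subset_zarClosure (S : Set (MvPolynomial (Fin 3) ℂ)) : S ⊆ ZarClosure S :=
  fun _ hH _ hΦ => hΦ _ hH

lemma tangent_homog {S : Set (MvPolynomial (Fin 3) ℂ)} (hS : ∀ H ∈ S, H.IsHomogeneous 4)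
    {F G : MvPolynomial (Fin 3) ℂ} (hG : G ∈ TangentAt (ZarClosure S) F) : G.IsHomogeneous 4 := by
  intro d hd
  by_contra hne
  apply hd
  rw [← derivEval_X d F G]
  refine hG _ (vanish_closure fun H hH => ?_)
  have : H.coeff d = 0 := by
    by_contra h0
    exact hne (hS H hH h0)
  simpa [coeffEval] using this

/-! ### Restriction to a line -/

lemma lr_add (F G : MvPolynomial (Fin 3) ℂ) (a b : Fin 3 → ℂ) :
    lineRestrict (F + G) a b = lineRestrict F a b + lineRestrict G a b := map_add _ _ _

lemma lr_mul (F G : MvPolynomial (Fin 3) ℂ) (a b : Fin 3 → ℂ) :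
    lineRestrict (F * G) a b = lineRestrict F a b * lineRestrict G a b := map_mul _ _ _

lemma lr_pow (F : MvPolynomial (Fin 3) ℂ) (n : ℕ) (a b : Fin 3 → ℂ) :
    lineRestrict (F ^ n) a b = lineRestrict F a b ^ n := map_pow _ _ _

lemma lr_smul (c : ℂ) (F : MvPolynomial (Fin 3) ℂ) (a b : Fin 3 → ℂ) :
    lineRestrict (c • F) a b = c • lineRestrict F a b := map_smul _ _ _

lemma lr_linForm (u a b : Fin 3 → ℂ) :
    lineRestrict (linForm u) a b = Polynomial.C (dotv u a) + Polynomial.C (dotv u b) *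
      Polynomial.X := by
  simp [lineRestrict, linForm, dotv, Fin.sum_univ_three]
  ring

lemma lr_eval (H : MvPolynomial (Fin 3) ℂ) (a b : Fin 3 → ℂ) (t : ℂ) :
    Polynomial.eval t (lineRestrict H a b) = MvPolynomial.eval (a + t • b) H := by
  unfold lineRestrict
  induction H using MvPolynomial.induction_on with
  | C a => simp
  | add p q hp hq => simp only [map_add, Polynomial.eval_add, hp, hq]
  | mul_X p d hp =>
    simp only [map_mul, Polynomial.eval_mul, hp, MvPolynomial.aeval_X, MvPolynomial.eval_X]
    congr 1
    simp
    ring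

lemma lr_coeff_zero (H : MvPolynomial (Fin 3) ℂ) (a b : Fin 3 → ℂ) :
    (lineRestrict H a b).coeff 0 = MvPolynomial.eval a H := by
  rw [Polynomial.coeff_zero_eq_eval_zero, lr_eval]; simp

lemma lr_coeff_one (H : MvPolynomial (Fin 3) ℂ) (a b : Fin 3 → ℂ) :
    (lineRestrict H a b).coeff 1 = dotv (gradVec H a) b := by
  induction H using MvPolynomial.induction_on with
  | C a => simp [lineRestrict, dotv, gradVec]
  | add p q hp hq =>
    rw [lr_add, Polynomial.coeff_add, hp, hq]
    simp [dotv, gradVec, Fin.sum_univ_three]; ring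
  | mul_X p i hp =>
    have h0 := lr_coeff_zero p a b
    rw [lr_mul, Polynomial.mul_coeff_one, hp, h0]
    have h1 : lineRestrict (MvPolynomial.X i) a b = Polynomial.C (a i) + Polynomial.C (b i) *
      Polynomial.X := MvPolynomial.aeval_X _ _
    rw [h1]
    fin_cases i <;> simp [dotv, gradVec, Fin.sum_univ_three, pderiv_X] <;> ring

lemma lr_natDegree {H : MvPolynomial (Fin 3) ℂ} (hH : H.IsHomogeneous 4) (a b : Fin 3 → ℂ) :
    (lineRestrict H a b).natDegree ≤ 4 := by
  have := MvPolynomial.aeval_natDegree_le H (m := 4) hH.totalDegree_le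
    (fun i => Polynomial.C (a i) + Polynomial.C (b i) * Polynomial.X) (n := 1)
    (fun i => by compute_degree)
  rw [mul_one] at this
  exact this

lemma lr_eval_pair {H : MvPolynomial (Fin 3) ℂ} (hH : H.IsHomogeneous 4) (a b : Fin 3 → ℂ)
    (x y : ℂ) : MvPolynomial.eval (x • a + y • b) H =
      ∑ k ∈ Finset.range 5, (lineRestrict H a b).coeff k * x ^ (4 - k) * y ^ k := by
  have hc1 : Continuous fun x : ℂ => MvPolynomial.eval (x • a + y • b) H :=
    (MvPolynomial.continuous_eval H).comp (by fun_prop)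
  have hc2 : Continuous fun x : ℂ =>
      ∑ k ∈ Finset.range 5, (lineRestrict H a b).coeff k * x ^ (4 - k) * y ^ k := by fun_prop
  refine congrFun (hc1.ext_on (dense_compl_singleton (0 : ℂ)) hc2 ?_) x
  intro x hx
  have hx0 : x ≠ 0 := hx
  have e : x • a + y • b = x • (a + (y / x) • b) := by
    rw [smul_add, smul_smul, mul_div_cancel₀ _ hx0]
  change MvPolynomial.eval (x • a + y • b) H = _
  rw [e, eval_smul_homog hH, ← lr_eval,
    Polynomial.eval_eq_sum_range' (n := 5) (by have := lr_natDegree hH a b; omega)]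
  simp only [Finset.sum_range_succ, Finset.sum_range_zero]
  field_simp
  norm_num
  ring

lemma lr_change {H : MvPolynomial (Fin 3) ℂ} (hH : H.IsHomogeneous 4) (a b : Fin 3 → ℂ)
    (x y z v : ℂ) : lineRestrict H (x • a + y • b) (z • a + v • b) =
      ∑ k ∈ Finset.range 5, Polynomial.C ((lineRestrict H a b).coeff k) *
        (Polynomial.C x + Polynomial.C z * Polynomial.X) ^ (4 - k) *
        (Polynomial.C y + Polynomial.C v * Polynomial.X) ^ k := by
  apply Polynomial.funext
  intro t
  have e : x • a + y • b + t • (z • a + v • b) = (x + z * t) • a + (y + v * t) • b := by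
    module
  rw [lr_eval, e, lr_eval_pair hH]
  simp [Polynomial.eval_finsetSum]

lemma contact_iff {H : MvPolynomial (Fin 3) ℂ} {a b : Fin 3 → ℂ} :
    3 ≤ contactAt H a b ↔ lineRestrict H a b ≠ 0 ∧ (lineRestrict H a b).coeff 0 = 0 ∧
      (lineRestrict H a b).coeff 1 = 0 ∧ (lineRestrict H a b).coeff 2 = 0 := by
  unfold contactAt
  by_cases h0 : lineRestrict H a b = 0
  · simp [h0]
  · rw [Polynomial.le_rootMultiplicity_iff h0, Polynomial.C_0, sub_zero, Polynomial.X_pow_dvd_iff]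
    constructor
    · intro h
      exact ⟨h0, h 0 (by norm_num), h 1 (by norm_num), h 2 (by norm_num)⟩
    · rintro ⟨_, h1, h2, h3⟩ d hd
      interval_cases d <;> assumption

lemma lr_eq_zero_of_dvd {H : MvPolynomial (Fin 3) ℂ} {w a b : Fin 3 → ℂ} (h : linForm w ∣ H)
    (ha : dotv w a = 0) (hb : dotv w b = 0) : lineRestrict H a b = 0 := by
  obtain ⟨T, rfl⟩ := h
  rw [lr_mul, lr_linForm, ha, hb]; simp

/-! ### Linear algebra on a line -/

lemma exists_comb {w a b p : Fin 3 → ℂ} (hw : w ≠ 0) (ha : dotv w a = 0) (hb : dotv w b = 0)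
    (hab : LinearIndependent ℂ ![a, b]) (hp : dotv w p = 0) : ∃ x y : ℂ, p = x • a + y • b := by
  let f : (Fin 3 → ℂ) →ₗ[ℂ] ℂ := ∑ i, w i • LinearMap.proj i
  have hf : ∀ x, f x = dotv w x := fun x => by simp [f, dotv]
  have hf0 : f ≠ 0 := by
    intro h
    apply hw
    funext i
    have := congrArg (fun g => g (Pi.single i 1)) h
    simpa [hf, dotv, Pi.single_apply] using this
  have hfin : Module.finrank ℂ (LinearMap.ker f) = 2 := by
    have h1 := LinearMap.finrank_range_add_finrank_ker f
    rw [LinearMap.range_eq_top.2 (LinearMap.surjective hf0)] at h1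
    simp at h1
    omega
  have hspan : Submodule.span ℂ (Set.range ![a, b]) = LinearMap.ker f := by
    apply Submodule.eq_of_le_of_finrank_eq
    · rw [Submodule.span_le]
      rintro _ ⟨i, rfl⟩
      fin_cases i <;> simp [hf, ha, hb]
    · rw [hfin, finrank_span_eq_card hab]; simp
  have hmem : p ∈ Submodule.span ℂ (Set.range ![a, b]) := by
    rw [hspan, LinearMap.mem_ker, hf, hp]
  rw [Matrix.range_cons, Matrix.range_cons, Matrix.range_empty, Set.union_empty,
    Set.singleton_union, Submodule.mem_span_pair] at hmem
  obtain ⟨x, y, h⟩ := hmem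
  exact ⟨x, y, h.symm⟩

lemma exists_indep {w p : Fin 3 → ℂ} (hp : p ≠ 0) :
    ∃ b, dotv w b = 0 ∧ LinearIndependent ℂ ![p, b] := by
  by_contra hcon
  push Not at hcon
  let f : (Fin 3 → ℂ) →ₗ[ℂ] ℂ := ∑ i, w i • LinearMap.proj i
  have hf : ∀ x, f x = dotv w x := fun x => by simp [f, dotv]
  have hfin : 2 ≤ Module.finrank ℂ (LinearMap.ker f) := by
    have h1 := LinearMap.finrank_range_add_finrank_ker f
    have h2 := Submodule.finrank_le (LinearMap.range f)
    simp at h1 h2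
    omega
  have hle : LinearMap.ker f ≤ Submodule.span ℂ {p} := by
    intro b hb
    have h1 := hcon b (by rw [← hf]; exact hb)
    by_contra h2
    apply h1
    rw [LinearIndependent.pair_iff' hp]
    intro c hc
    exact h2 (hc ▸ Submodule.smul_mem _ _ (Submodule.mem_span_singleton_self p))
  have := (Submodule.finrank_mono hle).trans (finrank_span_singleton hp).le
  omega

lemma exists_dual {p q : Fin 3 → ℂ} (h : LinearIndependent ℂ ![p, q]) :
    ∃ u v : Fin 3 → ℂ, dotv u p = 1 ∧ dotv u q = 0 ∧ dotv v p = 0 ∧ dotv v q = 1 := by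
  obtain ⟨g, hg⟩ := LinearMap.exists_leftInverse_of_injective
    (Fintype.linearCombination ℂ ![p, q]) (LinearMap.ker_eq_bot.2
      (linearIndependent_iff_injective_fintypeLinearCombination.1 h))
  have key : ∀ (k : Fin 2) (x : Fin 3 → ℂ),
      dotv (fun i => g (fun j => if i = j then 1 else 0) k) x = g x k := by
    intro k x
    rw [LinearMap.pi_apply_eq_sum_univ g x]
    simp [dotv, mul_comm]
  have hp : g p = ![1, 0] := by
    have := congrArg (fun f => f ![1, 0]) hg
    simpa [Fintype.linearCombination_apply] using this
  have hq : g q = ![0, 1] := by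
    have := congrArg (fun f => f ![0, 1]) hg
    simpa [Fintype.linearCombination_apply] using this
  refine ⟨_, _, key 0 p |>.trans ?_, key 0 q |>.trans ?_, key 1 p |>.trans ?_,
    key 1 q |>.trans ?_⟩ <;> simp [hp, hq]

lemma linForm_homog (u : Fin 3 → ℂ) : (linForm u).IsHomogeneous 1 := by
  refine MvPolynomial.IsHomogeneous.sum _ _ _ fun i _ => ?_
  simpa using (isHomogeneous_C (Fin 3) (u i)).mul (isHomogeneous_X ℂ i)

/-- Quartics restricting to the monomials on a line. -/
lemma exists_monomials {p q : Fin 3 → ℂ} (h : LinearIndependent ℂ ![p, q]) :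
    ∃ B : ℕ → MvPolynomial (Fin 3) ℂ, ∀ k ≤ 4, (B k).IsHomogeneous 4 ∧
      lineRestrict (B k) p q = Polynomial.X ^ k := by
  obtain ⟨u, v, h1, h2, h3, h4⟩ := exists_dual h
  refine ⟨fun k => linForm u ^ (4 - k) * linForm v ^ k, fun k hk => ⟨?_, ?_⟩⟩
  · have := ((linForm_homog u).pow (4 - k)).mul ((linForm_homog v).pow k)
    have e : 1 * (4 - k) + 1 * k = 4 := by omega
    rwa [e] at this
  · simp [lr_mul, lr_pow, lr_linForm, h1, h2, h3, h4]

/-- Coefficients of the restriction to a line, as linear equations on quartics. -/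
lemma exists_coeff_eq (p q : Fin 3 → ℂ) (k : ℕ) : ∃ A : MvPolynomial (Fin 3 →₀ ℕ) ℂ,
    (∀ H : MvPolynomial (Fin 3) ℂ, H.IsHomogeneous 4 →
      coeffEval A H = (lineRestrict H p q).coeff k) ∧
    ∀ F G : MvPolynomial (Fin 3) ℂ, G.IsHomogeneous 4 →
      derivEval A F G = (lineRestrict G p q).coeff k := by
  classical
  let T : Finset (Fin 3 →₀ ℕ) := Finset.finsuppAntidiag Finset.univ 4
  let α : (Fin 3 →₀ ℕ) → ℂ := fun d => (lineRestrict (MvPolynomial.monomial d 1) p q).coeff k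
  have hH : ∀ H : MvPolynomial (Fin 3) ℂ, H.IsHomogeneous 4 →
      (lineRestrict H p q).coeff k = ∑ d ∈ T, α d * H.coeff d := by
    intro H hH
    have hsub : H.support ⊆ T := by
      intro d hd
      have h1 := hH (MvPolynomial.mem_support_iff.1 hd)
      have h2 : d.degree = 4 := by
        rw [← h1]; exact DFunLike.congr_fun Finsupp.degree_eq_weight_one d
      rw [Finsupp.degree_eq_sum] at h2
      simp [T, Finset.mem_finsuppAntidiag, h2]
    have h3 : H = ∑ d ∈ T, H.coeff d • MvPolynomial.monomial d (1 : ℂ) := by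
      conv_lhs => rw [H.as_sum]
      rw [Finset.sum_subset hsub]
      · refine Finset.sum_congr rfl fun d _ => ?_
        rw [MvPolynomial.smul_monomial, smul_eq_mul, mul_one]
      · intro d _ hd
        rw [MvPolynomial.notMem_support_iff.1 hd, MvPolynomial.monomial_zero]
    conv_lhs => rw [h3]
    unfold lineRestrict
    rw [map_sum, Polynomial.finsetSum_coeff]
    refine Finset.sum_congr rfl fun d _ => ?_
    rw [map_smul, Polynomial.coeff_smul, smul_eq_mul, mul_comm]
    rfl
  refine ⟨∑ d ∈ T, MvPolynomial.C (α d) * MvPolynomial.X d, fun H h => ?_, fun F G hG => ?_⟩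
  · rw [hH H h]; simp [coeffEval]
  · rw [hH G hG]
    clear hH
    induction T using Finset.induction_on with
    | empty => simpa using derivEval_C 0 F G
    | insert d T hd ih =>
      rw [Finset.sum_insert hd, Finset.sum_insert hd, derivEval_add, ih, derivEval_mul,
        derivEval_C, coeffEval_C, derivEval_X, zero_mul, zero_add]

/-! ### The tangent spaces -/

lemma smul_homog (c : ℂ) {P : MvPolynomial (Fin 3) ℂ} (hP : P.IsHomogeneous 4) :
    (c • P).IsHomogeneous 4 := by
  rw [MvPolynomial.smul_eq_C_mul]
  simpa using (isHomogeneous_C (Fin 3) c).mul hP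

lemma arc_homog {F G H K : MvPolynomial (Fin 3) ℂ} (hF : F.IsHomogeneous 4)
    (hG : G.IsHomogeneous 4) (hH : H.IsHomogeneous 4) (hK : K.IsHomogeneous 4) (s : ℂ) :
    (F + s • G + s ^ 2 • H + s ^ 3 • K).IsHomogeneous 4 :=
  ((hF.add (smul_homog _ hG)).add (smul_homog _ hH)).add (smul_homog _ hK)

lemma not_dvd_of_lr {H : MvPolynomial (Fin 3) ℂ} {w a b : Fin 3 → ℂ} (ha : dotv w a = 0)
    (hb : dotv w b = 0) (h3 : (lineRestrict H a b).coeff 3 ≠ 0) : ¬ linForm w ∣ H := by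
  intro h
  rw [lr_eq_zero_of_dvd h ha hb] at h3
  simp at h3

lemma contact_of_coeff {H : MvPolynomial (Fin 3) ℂ} {a b : Fin 3 → ℂ}
    (h0 : (lineRestrict H a b).coeff 0 = 0) (h1 : (lineRestrict H a b).coeff 1 = 0)
    (h2 : (lineRestrict H a b).coeff 2 = 0) (h3 : (lineRestrict H a b).coeff 3 ≠ 0) :
    3 ≤ contactAt H a b := by
  refine contact_iff.2 ⟨fun h => h3 ?_, h0, h1, h2⟩
  rw [h]; simp

/-- The two equations of the discriminant-type locus of binary quartics with a triple root. -/
lemma triple_root_eqs {w p q : Fin 3 → ℂ} (hw : w ≠ 0) (hp : dotv w p = 0) (hq : dotv w q = 0)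
    {H : MvPolynomial (Fin 3) ℂ} (hH : memV0L w H) {c : ℕ → ℂ}
    (hc : ∀ k, c k = (lineRestrict H p q).coeff k) :
    12 * c 0 * c 4 - 3 * c 1 * c 3 + c 2 ^ 2 = 0 ∧
    72 * c 0 * c 2 * c 4 + 9 * c 1 * c 2 * c 3 - 27 * c 4 * c 1 ^ 2 - 27 * c 0 * c 3 ^ 2
      - 2 * c 2 ^ 3 = 0 := by
  obtain ⟨⟨hom, -⟩, -, a, b, ha, hb, hab, hcon⟩ := hH
  obtain ⟨-, h0, h1, h2⟩ := contact_iff.1 hcon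
  obtain ⟨x, y, rfl⟩ := exists_comb hw ha hb hab hp
  obtain ⟨z, v, rfl⟩ := exists_comb hw ha hb hab hq
  have hch := lr_change hom a b x y z v
  simp only [Finset.sum_range_succ, Finset.sum_range_zero, h0, h1, h2] at hch
  set m := (lineRestrict H a b).coeff 3
  set n := (lineRestrict H a b).coeff 4
  have hpoly : lineRestrict H (x • a + y • b) (z • a + v • b) =
      Polynomial.C (y ^ 3 * (m * x + n * y))
      + Polynomial.C (3 * y ^ 2 * v * (m * x + n * y) + y ^ 3 * (m * z + n * v)) * Polynomial.X
      + Polynomial.C (3 * y * v ^ 2 * (m * x + n * y) + 3 * y ^ 2 * v * (m * z + n * v))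
        * Polynomial.X ^ 2
      + Polynomial.C (v ^ 3 * (m * x + n * y) + 3 * y * v ^ 2 * (m * z + n * v))
        * Polynomial.X ^ 3
      + Polynomial.C (v ^ 3 * (m * z + n * v)) * Polynomial.X ^ 4 := by
    rw [hch]
    simp only [map_mul, map_add, map_pow, map_zero, Polynomial.C_ofNat]
    ring
  have e0 : c 0 = y ^ 3 * (m * x + n * y) := by
    rw [hc, hpoly]; simp [-map_mul, -map_add, Polynomial.coeff_X, Polynomial.coeff_C,
      Polynomial.coeff_X_pow]
  have e1 : c 1 = 3 * y ^ 2 * v * (m * x + n * y) + y ^ 3 * (m * z + n * v) := by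
    rw [hc, hpoly]; simp [-map_mul, -map_add, Polynomial.coeff_X, Polynomial.coeff_C,
      Polynomial.coeff_X_pow]
  have e2 : c 2 = 3 * y * v ^ 2 * (m * x + n * y) + 3 * y ^ 2 * v * (m * z + n * v) := by
    rw [hc, hpoly]; simp [-map_mul, -map_add, Polynomial.coeff_X, Polynomial.coeff_C,
      Polynomial.coeff_X_pow]
  have e3 : c 3 = v ^ 3 * (m * x + n * y) + 3 * y * v ^ 2 * (m * z + n * v) := by
    rw [hc, hpoly]; simp [-map_mul, -map_add, Polynomial.coeff_X, Polynomial.coeff_C,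
      Polynomial.coeff_X_pow]
  have e4 : c 4 = v ^ 3 * (m * z + n * v) := by
    rw [hc, hpoly]; simp [-map_mul, -map_add, Polynomial.coeff_X, Polynomial.coeff_C,
      Polynomial.coeff_X_pow]
  rw [e0, e1, e2, e3, e4]
  constructor <;> ring

lemma tangent_VL {F : MvPolynomial (Fin 3) ℂ} (hF : F.IsHomogeneous 4) (hN : Nodal F)
    {w p q : Fin 3 → ℂ} (hw : w ≠ 0) (hp : dotv w p = 0) (hq : dotv w q = 0)
    (hpq : LinearIndependent ℂ ![p, q]) (hFq : MvPolynomial.eval q F = 0)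
    (hcon : 3 ≤ contactAt F p q) :
    TangentAt (VL w) F =
      {G | G.IsHomogeneous 4 ∧ MvPolynomial.eval p G = 0 ∧ dotv (gradVec G p) q = 0} := by
  obtain ⟨hne, f0, f1, f2⟩ := contact_iff.1 hcon
  have f4 : (lineRestrict F p q).coeff 4 = 0 := by
    have h := lr_eval_pair hF p q 0 1
    simp only [zero_smul, one_smul, zero_add, hFq] at h
    simpa [Finset.sum_range_succ] using h.symm
  set c := (lineRestrict F p q).coeff 3 with hcdef
  have hc : c ≠ 0 := by
    intro h
    apply hne
    ext k
    rw [Polynomial.coeff_zero]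
    by_cases hk : k ≤ 4
    · interval_cases k <;> assumption
    · exact Polynomial.coeff_eq_zero_of_natDegree_lt
        (lt_of_le_of_lt (lr_natDegree hF p q) (not_le.1 hk))
  obtain ⟨B, hB⟩ := exists_monomials hpq
  ext G
  simp only [Set.mem_ofPred_eq]
  constructor
  · intro hG
    have hGh : G.IsHomogeneous 4 := tangent_homog (fun H hH => hH.1.1) hG
    refine ⟨hGh, ?_⟩
    choose A hA hA' using exists_coeff_eq p q
    have hI : ∀ H ∈ VL w, coeffEval (MvPolynomial.C 12 * (A 0 * A 4)
        + MvPolynomial.C (-3) * (A 1 * A 3) + A 2 * A 2) H = 0 := by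
      refine vanish_closure fun H hH => ?_
      have h := (triple_root_eqs hw hp hq hH (c := fun k => (lineRestrict H p q).coeff k)
        (fun _ => rfl)).1
      simp only [coeffEval_add, coeffEval_mul, coeffEval_C, hA _ _ hH.1.1]
      linear_combination h
    have hJ : ∀ H ∈ VL w, coeffEval (MvPolynomial.C 72 * (A 0 * (A 2 * A 4))
        + MvPolynomial.C 9 * (A 1 * (A 2 * A 3)) + MvPolynomial.C (-27) * (A 4 * (A 1 * A 1))
        + MvPolynomial.C (-27) * (A 0 * (A 3 * A 3))
        + MvPolynomial.C (-2) * (A 2 * (A 2 * A 2))) H = 0 := by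
      refine vanish_closure fun H hH => ?_
      have h := (triple_root_eqs hw hp hq hH (c := fun k => (lineRestrict H p q).coeff k)
        (fun _ => rfl)).2
      simp only [coeffEval_add, coeffEval_mul, coeffEval_C, hA _ _ hH.1.1]
      linear_combination h
    have dI := hG _ hI
    have dJ := hG _ hJ
    simp only [derivEval_add, derivEval_mul, derivEval_C, coeffEval_mul, coeffEval_C, hA _ _ hF,
      hA' _ _ _ hGh, f0, f1, f2, f4, ← hcdef] at dI dJ
    constructor
    · rw [← lr_coeff_zero G p q]
      have h : (c ^ 2) * (lineRestrict G p q).coeff 0 = 0 := by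
        linear_combination (-1 / 27 : ℂ) * dJ
      exact (mul_eq_zero.1 h).resolve_left (pow_ne_zero 2 hc)
    · rw [← lr_coeff_one G p q]
      have h : c * (lineRestrict G p q).coeff 1 = 0 := by
        linear_combination (-1 / 3 : ℂ) * dI
      exact (mul_eq_zero.1 h).resolve_left hc
  · rintro ⟨hGh, g0, g1⟩ Φ hΦ
    rw [← lr_coeff_zero G p q] at g0
    rw [← lr_coeff_one G p q] at g1
    have hΦ0 : ∀ H, memV0L w H → coeffEval Φ H = 0 := fun H hH =>
      hΦ H (subset_zarClosure _ hH)
    set κ := (lineRestrict G p q).coeff 2 with hκ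
    obtain ⟨hB0, rB0⟩ := hB 0 (by norm_num)
    obtain ⟨hB1, rB1⟩ := hB 1 (by norm_num)
    obtain ⟨hB2, rB2⟩ := hB 2 (by norm_num)
    have h0h : (0 : MvPolynomial (Fin 3) ℂ).IsHomogeneous 4 := isHomogeneous_zero _ _ _
    -- first arc: fixed contact point
    have d1 : derivEval Φ F (G + (-κ) • B 2) = 0 := by
      have hGkh : (G + (-κ) • B 2).IsHomogeneous 4 := hGh.add (smul_homog _ hB2)
      refine (curve_lemma Φ F (G + (-κ) • B 2) 0 0 ?_).2
      have hev := hN.eventually hF hGkh h0h h0h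
      have hcont : ContinuousAt (fun s : ℂ => c + s * (lineRestrict G p q).coeff 3) 0 := by
        fun_prop
      have hev2 := hcont.eventually_ne (y := 0) (by simpa using hc)
      refine eventually_nhdsWithin_of_eventually_nhds ?_
      filter_upwards [hev, hev2] with s hs hs2
      apply hΦ0
      have hco : ∀ k, (lineRestrict (F + s • (G + (-κ) • B 2) + s ^ 2 • 0 + s ^ 3 • 0) p q).coeff k
          = (lineRestrict F p q).coeff k + s * ((lineRestrict G p q).coeff k
            - κ * (Polynomial.X ^ 2 : Polynomial ℂ).coeff k) := by
        intro k
        simp only [smul_zero, add_zero, lr_add, lr_smul, rB2, Polynomial.coeff_add,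
          Polynomial.coeff_smul, smul_eq_mul]
        ring
      have k3 : (lineRestrict (F + s • (G + (-κ) • B 2) + s ^ 2 • 0 + s ^ 3 • 0) p q).coeff 3
          ≠ 0 := by
        rw [hco]; simpa [Polynomial.coeff_X_pow] using hs2
      refine ⟨hs.memV (arc_homog hF hGkh h0h h0h s), not_dvd_of_lr hp hq k3, p, q, hp, hq, hpq,
        contact_of_coeff ?_ ?_ ?_ k3⟩
      · rw [hco]; simp [f0, g0]
      · rw [hco]; simp [f1, g1, Polynomial.coeff_X]
      · rw [hco]; simp [f2, ← hκ]
    -- second arc: moving contact point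
    have d2 : derivEval Φ F ((3 * c) • B 2) = 0 := by
      have m2 := smul_homog (3 * c) hB2
      have m1 := smul_homog (3 * c) hB1
      have m0 := smul_homog c hB0
      refine (curve_lemma Φ F ((3 * c) • B 2) ((3 * c) • B 1) (c • B 0) ?_).2
      refine eventually_nhdsWithin_of_eventually_nhds ?_
      filter_upwards [hN.eventually hF m2 m1 m0] with s hs
      apply hΦ0
      have hom := arc_homog hF m2 m1 m0 s
      set H := F + s • ((3 * c) • B 2) + s ^ 2 • ((3 * c) • B 1) + s ^ 3 • (c • B 0) with hH
      have hco : ∀ k, (lineRestrict H p q).coeff k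
          = (lineRestrict F p q).coeff k
            + s * (3 * c * (Polynomial.X ^ 2 : Polynomial ℂ).coeff k)
            + s ^ 2 * (3 * c * (Polynomial.X ^ 1 : Polynomial ℂ).coeff k)
            + s ^ 3 * (c * (Polynomial.X ^ 0 : Polynomial ℂ).coeff k) := by
        intro k
        simp only [hH, lr_add, lr_smul, rB2, rB1, rB0, Polynomial.coeff_add,
          Polynomial.coeff_smul, smul_eq_mul]
      have hres : lineRestrict H (p + (-s) • q) q = Polynomial.C c * Polynomial.X ^ 3 := by
        have h := lr_change hom p q 1 (-s) 0 1
        rw [one_smul, zero_smul, one_smul, zero_add] at h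
        rw [h]
        simp only [Finset.sum_range_succ, Finset.sum_range_zero, hco, f0, f1, f2, f4, ← hcdef,
          Polynomial.coeff_X_pow]
        norm_num
        simp only [Polynomial.C_ofNat]
        ring
      have ha : dotv w (p + (-s) • q) = 0 := by
        have : dotv w (p + (-s) • q) = dotv w p + (-s) * dotv w q := by
          simp [dotv, Fin.sum_univ_three]; ring
        rw [this, hp, hq]; simp
      have hind : LinearIndependent ℂ ![p + (-s) • q, q] := by
        rw [LinearIndependent.pair_iff] at hpq ⊢
        intro x y hxy
        have h := hpq x (y - s * x) (by rw [← hxy]; module)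
        refine ⟨h.1, ?_⟩
        have h2 := h.2
        rw [h.1] at h2
        simpa using h2
      have k3 : (lineRestrict H (p + (-s) • q) q).coeff 3 ≠ 0 := by
        rw [hres]; simpa using hc
      refine ⟨hs.memV hom, not_dvd_of_lr ha hq k3, _, q, ha, hq, hind,
        contact_of_coeff ?_ ?_ ?_ k3⟩ <;>
      · rw [hres]; simp [Polynomial.coeff_X_pow]
    have hGeq : G = (G + (-κ) • B 2) + (κ / (3 * c)) • ((3 * c) • B 2) := by
      rw [smul_smul, div_mul_cancel₀ _ (mul_ne_zero three_ne_zero hc)]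
      module
    rw [hGeq, derivEval_linear, d1, d2]
    simp

lemma tangent_VLp {F : MvPolynomial (Fin 3) ℂ} (hF : F.IsHomogeneous 4) (hN : Nodal F)
    {w p : Fin 3 → ℂ} (hw : w ≠ 0) (hdvd : linForm w ∣ F) (hp0 : p ≠ 0) (hp : dotv w p = 0) :
    F ∈ VLp w p ∧ TangentAt (VLp w p) F =
        {G | G.IsHomogeneous 4 ∧
          ∀ b : Fin 3 → ℂ, dotv w b = 0 → LinearIndependent ℂ ![p, b] →
            (lineRestrict G p b).coeff 0 = 0 ∧ (lineRestrict G p b).coeff 1 = 0 ∧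
            (lineRestrict G p b).coeff 2 = 0} := by
  obtain ⟨q, hq, hpq⟩ := exists_indep (w := w) hp0
  have hFL : lineRestrict F p q = 0 := lr_eq_zero_of_dvd hdvd hp hq
  obtain ⟨B, hB⟩ := exists_monomials hpq
  obtain ⟨hB3, rB3⟩ := hB 3 (by norm_num)
  have h0h : (0 : MvPolynomial (Fin 3) ℂ).IsHomogeneous 4 := isHomogeneous_zero _ _ _
  have key : ∀ (Φ : MvPolynomial (Fin 3 →₀ ℕ) ℂ), (∀ H, memV0Lp w p H → coeffEval Φ H = 0) →
      ∀ G : MvPolynomial (Fin 3) ℂ, G.IsHomogeneous 4 →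
      (lineRestrict G p q).coeff 0 = 0 → (lineRestrict G p q).coeff 1 = 0 →
      (lineRestrict G p q).coeff 2 = 0 → (lineRestrict G p q).coeff 3 ≠ 0 →
      coeffEval Φ F = 0 ∧ derivEval Φ F G = 0 := by
    intro Φ hΦ G hG g0 g1 g2 g3
    refine curve_lemma Φ F G 0 0 ?_
    rw [eventually_nhdsWithin_iff]
    filter_upwards [hN.eventually hF hG h0h h0h] with s hs hs0
    have hs0' : s ≠ 0 := hs0
    apply hΦ
    have hco : ∀ k, (lineRestrict (F + s • G + s ^ 2 • 0 + s ^ 3 • 0) p q).coeff k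
          = s * (lineRestrict G p q).coeff k := by
      intro k
      simp [lr_add, lr_smul, hFL]
    have k3 : (lineRestrict (F + s • G + s ^ 2 • 0 + s ^ 3 • 0) p q).coeff 3 ≠ 0 := by
      rw [hco]; exact mul_ne_zero hs0' g3
    refine ⟨hs.memV (arc_homog hF hG h0h h0h s), not_dvd_of_lr hp hq k3, q, hq, hpq,
        contact_of_coeff ?_ ?_ ?_ k3⟩
    · rw [hco, g0, mul_zero]
    · rw [hco, g1, mul_zero]
    · rw [hco, g2, mul_zero]
  have keyB := fun Φ hΦ => key Φ hΦ (B 3) hB3 (by simp [rB3]) (by simp [rB3, Polynomial.coeff_X_pow])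
    (by simp [rB3, Polynomial.coeff_X_pow]) (by simp [rB3])
  refine ⟨fun Φ hΦ => (keyB Φ hΦ).1, ?_⟩
  ext G
  simp only [Set.mem_ofPred_eq]
  constructor
  · intro hG
    have hGh : G.IsHomogeneous 4 := tangent_homog (fun H hH => hH.1.1) hG
    refine ⟨hGh, fun b hb hpb => ?_⟩
    have hvan : ∀ H, memV0Lp w p H → ∀ k < 3, (lineRestrict H p b).coeff k = 0 := by
      rintro H ⟨⟨hom, -⟩, -, bc, hbc, hpc, hcon⟩
      obtain ⟨-, h0, h1, h2⟩ := contact_iff.1 hcon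
      obtain ⟨x, y, rfl⟩ := exists_comb hw hp hbc hpc hb
      have h := lr_change hom p bc 1 0 x y
      rw [one_smul, zero_smul, add_zero] at h
      simp only [Finset.sum_range_succ, Finset.sum_range_zero, h0, h1, h2, map_zero, zero_mul,
        zero_add] at h
      rw [← Polynomial.X_pow_dvd_iff, h]
      refine dvd_add ?_ ?_
      · refine Dvd.dvd.mul_left ?_ _
        rw [mul_pow]
        exact Dvd.intro_left _ rfl
      · refine Dvd.dvd.mul_left ?_ _
        rw [mul_pow]
        exact Dvd.dvd.mul_left (pow_dvd_pow _ (by norm_num)) _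
    have hfin : ∀ k < 3, (lineRestrict G p b).coeff k = 0 := by
      intro k hk
      obtain ⟨A, hA, hA'⟩ := exists_coeff_eq p b k
      rw [← hA' F G hGh]
      refine hG _ (vanish_closure fun H hH => ?_)
      rw [hA H hH.1.1]
      exact hvan H hH k hk
    exact ⟨hfin 0 (by norm_num), hfin 1 (by norm_num), hfin 2 (by norm_num)⟩
  · rintro ⟨hGh, hall⟩ Φ hΦ
    obtain ⟨g0, g1, g2⟩ := hall q hq hpq
    have hΦ0 : ∀ H, memV0Lp w p H → coeffEval Φ H = 0 := fun H hH =>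
      hΦ H (subset_zarClosure _ hH)
    by_cases g3 : (lineRestrict G p q).coeff 3 = 0
    · have h := (key Φ hΦ0 (G + (1 : ℂ) • B 3) (hGh.add (smul_homog _ hB3))
        (by simp [lr_add, g0, rB3]) (by simp [lr_add, g1, rB3, Polynomial.coeff_X_pow])
        (by simp [lr_add, g2, rB3, Polynomial.coeff_X_pow])
        (by simp [lr_add, g3, rB3])).2
      rw [derivEval_linear, (keyB Φ hΦ0).2] at h
      simpa using h
    · exact (key Φ hΦ0 G hGh g0 g1 g2 g3).2

theorem tangent_spaces_of_VL_and_VLp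
    (F : MvPolynomial (Fin 3) ℂ) (hFV : memV F)
    -- `C` is nodal:
    (hnodal : ∀ x : Fin 3 → ℂ, x ≠ 0 → SingAt F x → IsNodeAt F x)
    (w : Fin 3 → ℂ) (hw : w ≠ 0) :
    -- (i) `L ⊄ C`, `C ∩ L = {p, q} ⊆ C^{sm}`, `p ≠ q`, `p` non-reduced:
    (∀ p q : Fin 3 → ℂ, ¬ linForm w ∣ F →
      dotv w p = 0 → dotv w q = 0 → LinearIndependent ℂ ![p, q] →
      SmoothAt F p → SmoothAt F q → 3 ≤ contactAt F p q →
      (∀ x : Fin 3 → ℂ, x ≠ 0 → dotv w x = 0 → eval x F = 0 →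
        propor x p ∨ propor x q) →
      -- `T_{[C]}𝒱_L ≃ H⁰(C, 𝒪_C(4)(−2p))`, i.e. the tangent space is the space of
      -- quartics vanishing to order `≥ 2` on `C` at `p`:
      TangentAt (VL w) F =
        {G | G.IsHomogeneous 4 ∧ MvPolynomial.eval p G = 0 ∧ dotv (gradVec G p) q = 0}) ∧
    -- (ii) `L ⊄ C`, `C ∩ L = {p, q}` with `p` a node, `q` smooth, `L` tangent at `p`
    -- to the branch `p₁`:
    (∀ p q : Fin 3 → ℂ, ¬ linForm w ∣ F →
      dotv w p = 0 → dotv w q = 0 → LinearIndependent ℂ ![p, q] →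
      IsNodeAt F p → SmoothAt F q → 3 ≤ contactAt F p q →
      (∀ x : Fin 3 → ℂ, x ≠ 0 → dotv w x = 0 → eval x F = 0 →
        propor x p ∨ propor x q) →
      -- `T_{[C]}𝒱_L ≃ H⁰(Cᵛ, ν*𝒪_C(4)(−2p₁ − p₂))`: quartics vanishing at the node
      -- to order `≥ 2` along the branch tangent to `L` (and `≥ 1` on the other):
      TangentAt (VL w) F =
        {G | G.IsHomogeneous 4 ∧ MvPolynomial.eval p G = 0 ∧ dotv (gradVec G p) q = 0}) ∧
    -- (iii) `L ⊆ C` and `p ∈ C^{sm} ∩ L`: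
    (∀ p : Fin 3 → ℂ, linForm w ∣ F → p ≠ 0 → dotv w p = 0 → SmoothAt F p →
      -- `[C] ∈ 𝒱_{L,p}`:
      F ∈ VLp w p ∧
      -- `T_{[C]}𝒱_{L,p} ≃ H⁰(C, 𝒪_C(4)(−3p))`: quartics vanishing to order `≥ 3`
      -- along `L ⊆ C` at `p`:
      TangentAt (VLp w p) F =
        {G | G.IsHomogeneous 4 ∧
          ∀ b : Fin 3 → ℂ, dotv w b = 0 → LinearIndependent ℂ ![p, b] →
            (lineRestrict G p b).coeff 0 = 0 ∧ (lineRestrict G p b).coeff 1 = 0 ∧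
            (lineRestrict G p b).coeff 2 = 0}) := by
  refine ⟨fun p q _ hp hq hpq _ hsq hcon _ => ?_, fun p q _ hp hq hpq _ hsq hcon _ => ?_,
    fun p hdvd hp0 hp _ => ?_⟩
  · exact tangent_VL hFV.1 hnodal hw hp hq hpq hsq.1 hcon
  · exact tangent_VL hFV.1 hnodal hw hp hq hpq hsq.1 hcon
  · exact tangent_VLp hFV.1 hnodal hw hdvd hp0 hp

end Infl
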